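/- Let f : ℝ² → ℝ be a C^∞ function with f(0) = 0 and ∇f(0) = 0, and let ψ : ℝ² → ℝ be a C^∞ compactly supported function with ψ ≡ 1 on a neighborhood of 0. For Re s > -2 define B(s) = ∫_{ℝ²} (‖w‖² + f(w)²)^{s/2} ψ(w) √(1 + ‖∇f(w)‖²) dw. Write the Taylor expansion of f at 0 as f(x,y) = b₁x² + b₂xy + b₃y² + c₁x³ + c₂x²y + c₃xy² + c₄y³ + d₁x⁴ + d₂x³y + d₃x²y² + d₄xy³ + d₅y⁴ + O(‖(x,y)‖⁵) (so b₁ = (1/2)∂ₓ²f(0), b₂ = ∂ₓ∂ᵧf(0), b₃ = (1/2)∂ᵧ²f(0), c₁ = (1/6)∂ₓ³f(0), c₂ = (1/2)∂ₓ²∂ᵧf(0), c₃ = (1/2)∂ₓ∂ᵧ²f(0), c₄ = (1/6)∂ᵧ³f(0), d₁ = (1/24)∂ₓ⁴f(0), d₂ = (1/6)∂ₓ³∂ᵧf(0), d₃ = (1/4)∂ₓ²∂ᵧ²f(0), d₄ = (1/6)∂ₓ∂ᵧ³f(0), d₅ = (1/24)∂ᵧ⁴f(0)). Then there exists a function F :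 ℂ → ℂ with F(s) = B(s) for Re s > -2, F complex differentiable at every point of {s : Re s > -7} \ {−2, −4, −6}, and such that the limit as s → −6 of (s + 6)·F(s) exists and equals (π/32)·(72b₃d₅ − 24b₁d₅ + 24b₂d₄ + 48c₄² + 8b₃d₃ + 8b₁d₃ + 16c₃² − 63b₃⁴ + 12b₁b₃³ − 66b₂²b₃² − 26b₁²b₃² − 44b₁b₂²b₃ − 24b₃d₁ + 12b₁³b₃ + 24b₂d₂ + 16c₂² − 11b₂⁴ − 66b₁²b₂² + 72b₁d₁ + 48c₁² − 63b₁⁴). -/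

import Mathlib

open MeasureTheory Complex Filter

namespace Bry

abbrev E2 := EuclideanSpace ℝ (Fin 2)

/-- Directional derivative operator. -/
noncomputable def D (v : E2) (u : E2 → ℝ) : E2 → ℝ := fun w => fderiv ℝ u w v

lemma D_smooth {u : E2 → ℝ} (hu : ContDiff ℝ (⊤ : ℕ∞) u) (v : E2) :
    ContDiff ℝ (⊤ : ℕ∞) (D v u) := by
  unfold D
  exact (hu.fderiv_right (m := (⊤ : ℕ∞)) (by simp)).clm_apply contDiff_const

lemma D_lin_left (u : E2 → ℝ) (x y : ℝ) (v v' : E2) :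
    D (x • v + y • v') u = fun w => x * D v u w + y * D v' u w := by
  funext w; simp [D]

lemma D_lin_right {u u' : E2 → ℝ} (hu : ContDiff ℝ (⊤ : ℕ∞) u) (hu' : ContDiff ℝ (⊤ : ℕ∞) u')
    (x y : ℝ) (v : E2) :
    D v (fun w => x * u w + y * u' w) = fun w => x * D v u w + y * D v u' w := by
  funext w
  have h1 : DifferentiableAt ℝ u w := (hu.differentiable (by simp)) w
  have h2 : DifferentiableAt ℝ u' w := (hu'.differentiable (by simp)) w
  unfold D
  rw [fderiv_fun_add (h1.const_mul x) (h2.const_mul y), fderiv_const_mul h1, fderiv_const_mul h2]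
  simp

lemma D_comm {u : E2 → ℝ} (hu : ContDiff ℝ (⊤ : ℕ∞) u) (v v' : E2) :
    D v (D v' u) = D v' (D v u) := by
  funext w
  have hs : IsSymmSndFDerivAt ℝ u w := (hu.contDiffAt).isSymmSndFDerivAt
    (by simp only [minSmoothness_of_isRCLikeNormedField]; exact WithTop.coe_le_coe.2 le_top)
  have hd : DifferentiableAt ℝ (fderiv ℝ u) w :=
    ((hu.fderiv_right (m := (⊤ : ℕ∞)) (by simp)).differentiable (by simp)) w
  have key : ∀ a b : E2, D a (D b u) w = fderiv ℝ (fderiv ℝ u) w a b := by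
    intro a b
    unfold D
    rw [fderiv_clm_apply hd (by fun_prop)]
    simp
  rw [key, key]
  exact hs _ _

lemma itf_succ {u : E2 → ℝ} (hu : ContDiff ℝ (⊤ : ℕ∞) u) (n : ℕ) (m : Fin (n + 1) → E2) (x : E2) :
    iteratedFDeriv ℝ (n + 1) u x m = iteratedFDeriv ℝ n (D (m (Fin.last n)) u) x (Fin.init m) := by
  rw [iteratedFDeriv_succ_apply_right]
  have h := (ContinuousLinearMap.apply ℝ ℝ (m (Fin.last n))).iteratedFDeriv_comp_left
    (f := fderiv ℝ u) (x := x) (i := n) (n := (⊤ : ℕ∞))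
    ((hu.fderiv_right (m := (⊤ : ℕ∞)) (by simp)).contDiffAt) (by exact_mod_cast le_top)
  have h2 : (⇑(ContinuousLinearMap.apply ℝ ℝ (m (Fin.last n))) ∘ fderiv ℝ u)
      = D (m (Fin.last n)) u := by
    funext w; simp [D]
  rw [h2] at h
  rw [h]
  simp

lemma itf2 {u : E2 → ℝ} (hu : ContDiff ℝ (⊤ : ℕ∞) u) (m : Fin 2 → E2) (x : E2) :
    iteratedFDeriv ℝ 2 u x m = D (m 0) (D (m 1) u) x := by
  rw [itf_succ hu 1 m x, itf_succ (D_smooth hu _)]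
  rfl

lemma itf1 {u : E2 → ℝ} (hu : ContDiff ℝ (⊤ : ℕ∞) u) (m : Fin 1 → E2) (x : E2) :
    iteratedFDeriv ℝ 1 u x m = D (m 0) u x := by
  rw [itf_succ hu 0 m x]
  rfl

lemma itf3 {u : E2 → ℝ} (hu : ContDiff ℝ (⊤ : ℕ∞) u) (m : Fin 3 → E2) (x : E2) :
    iteratedFDeriv ℝ 3 u x m = D (m 0) (D (m 1) (D (m 2) u)) x := by
  rw [itf_succ hu 2 m x, itf2 (D_smooth hu _)]
  rfl

lemma itf4 {u : E2 → ℝ} (hu : ContDiff ℝ (⊤ : ℕ∞) u) (m : Fin 4 → E2) (x : E2) :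
    iteratedFDeriv ℝ 4 u x m = D (m 0) (D (m 1) (D (m 2) (D (m 3) u))) x := by
  rw [itf_succ hu 3 m x, itf3 (D_smooth hu _)]
  rfl

lemma taylor_bound {u : E2 → ℝ} (hu : ContDiff ℝ (⊤ : ℕ∞) u) (n : ℕ) (R : ℝ) :
    ∃ C : ℝ, 0 ≤ C ∧ ∀ w : E2, ‖w‖ ≤ R →
      |u w - ∑ k ∈ Finset.range (n + 1), (k.factorial : ℝ)⁻¹ * iteratedFDeriv ℝ k u 0 (fun _ => w)|
        ≤ C * ‖w‖ ^ (n + 1) := by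
  have hc : Continuous (iteratedFDeriv ℝ (n + 1) u) :=
    hu.continuous_iteratedFDeriv (by exact_mod_cast le_top)
  obtain ⟨C, hC⟩ := (isCompact_closedBall (0 : E2) R).exists_bound_of_continuousOn hc.continuousOn
  refine ⟨max C 0, le_max_right _ _, fun w hw => ?_⟩
  have h := map_add_eq_sum_add_integral_iteratedFDeriv (f := u) (x := 0) (y := w) (n := n)
    (fun t _ => (hu.contDiffAt).of_le (by exact_mod_cast le_top))
  rw [zero_add] at h
  rw [h]
  simp only [smul_eq_mul, zero_add]
  rw [add_sub_cancel_left, abs_mul]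
  have hb : ‖∫ t in (0:ℝ)..1, (1 - t)^n * iteratedFDeriv ℝ (n + 1) u (t • w) (fun _ ↦ w)‖
      ≤ (max C 0 * ‖w‖ ^ (n + 1)) * |1 - 0| := by
    apply intervalIntegral.norm_integral_le_of_norm_le_const
    intro t ht
    rw [Set.uIoc_of_le zero_le_one] at ht
    rw [norm_mul]
    have h1 : ‖(1 - t) ^ n‖ ≤ 1 := by
      rw [Real.norm_eq_abs, abs_of_nonneg (pow_nonneg (by linarith [ht.2]) _)]
      exact pow_le_one₀ (by linarith [ht.2]) (by linarith [ht.1])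
    have h2 : ‖iteratedFDeriv ℝ (n + 1) u (t • w) (fun _ ↦ w)‖ ≤ max C 0 * ‖w‖ ^ (n + 1) := by
      refine (ContinuousMultilinearMap.le_opNorm _ _).trans ?_
      simp only [Finset.prod_const, Finset.card_univ, Fintype.card_fin]
      gcongr
      refine (hC _ ?_).trans (le_max_left _ _)
      rw [mem_closedBall_zero_iff, norm_smul, Real.norm_eq_abs, abs_of_pos ht.1]
      nlinarith [norm_nonneg w, ht.2, ht.1]
    calc _ ≤ 1 * (max C 0 * ‖w‖ ^ (n + 1)) := by gcongr
      _ = _ := one_mul _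
  rw [Real.norm_eq_abs] at hb
  have hn : |((n.factorial : ℝ))⁻¹| ≤ 1 := by
    rw [abs_of_nonneg (by positivity)]
    apply inv_le_one_of_one_le₀
    exact_mod_cast Nat.succ_le_of_lt (Nat.factorial_pos n)
  calc _ ≤ 1 * ((max C 0 * ‖w‖ ^ (n + 1)) * |1 - 0|) := by gcongr
    _ = _ := by simp

lemma D_w1 (u : E2 → ℝ) (x y : ℝ) (ex ey z : E2) :
    D (x • ex + y • ey) u z = x * D ex u z + y * D ey u z := by
  rw [D_lin_left]

lemma D_w2 {u : E2 → ℝ} (hu : ContDiff ℝ (⊤ : ℕ∞) u) (x y : ℝ) (ex ey z : E2) :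
    D (x • ex + y • ey) (D (x • ex + y • ey) u) z =
      x ^ 2 * D ex (D ex u) z + 2 * x * y * D ey (D ex u) z + y ^ 2 * D ey (D ey u) z := by
  rw [D_lin_left u, D_lin_right (D_smooth hu _) (D_smooth hu _), D_lin_left, D_lin_left,
    D_comm hu ex ey]
  ring

lemma D_w3 {u : E2 → ℝ} (hu : ContDiff ℝ (⊤ : ℕ∞) u) (x y : ℝ) (ex ey z : E2) :
    D (x • ex + y • ey) (D (x • ex + y • ey) (D (x • ex + y • ey) u)) z =
      x ^ 3 * D ex (D ex (D ex u)) z + 3 * x ^ 2 * y * D ey (D ex (D ex u)) z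
       + 3 * x * y ^ 2 * D ey (D ey (D ex u)) z + y ^ 3 * D ey (D ey (D ey u)) z := by
  have hX := D_smooth hu ex
  have hY := D_smooth hu ey
  rw [D_lin_left u, D_lin_right hX hY, D_lin_right (D_smooth hX _) (D_smooth hY _)]
  beta_reduce
  rw [D_w2 hX, D_w2 hY, D_comm hu ex ey, D_comm hX ex ey]
  ring

lemma D_w4 {u : E2 → ℝ} (hu : ContDiff ℝ (⊤ : ℕ∞) u) (x y : ℝ) (ex ey z : E2) :
    D (x • ex + y • ey) (D (x • ex + y • ey) (D (x • ex + y • ey) (D (x • ex + y • ey) u))) z =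
      x ^ 4 * D ex (D ex (D ex (D ex u))) z + 4 * x ^ 3 * y * D ey (D ex (D ex (D ex u))) z
       + 6 * x ^ 2 * y ^ 2 * D ey (D ey (D ex (D ex u))) z
       + 4 * x * y ^ 3 * D ey (D ey (D ey (D ex u))) z + y ^ 4 * D ey (D ey (D ey (D ey u))) z := by
  have hX := D_smooth hu ex
  have hY := D_smooth hu ey
  rw [D_lin_left u, D_lin_right hX hY, D_lin_right (D_smooth hX _) (D_smooth hY _),
    D_lin_right (D_smooth (D_smooth hX _) _) (D_smooth (D_smooth hY _) _)]
  beta_reduce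
  rw [D_w3 hX, D_w3 hY, D_comm hu ex ey, D_comm hX ex ey, D_comm (D_smooth hX ex) ex ey]
  ring

set_option linter.unusedSimpArgs false in
set_option maxHeartbeats 1000000 in
lemma taylor_f {f : E2 → ℝ} (hf : ContDiff ℝ (⊤ : ℕ∞) f) (hf0 : f 0 = 0)
    (ex ey : E2) (hx0 : D ex f 0 = 0) (hy0 : D ey f 0 = 0)
    (b₁ b₂ b₃ c₁ c₂ c₃ c₄ d₁ d₂ d₃ d₄ d₅ : ℝ)
    (hb₁ : b₁ = (1 / 2) * iteratedFDeriv ℝ 2 f 0 ![ex, ex])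
    (hb₂ : b₂ = iteratedFDeriv ℝ 2 f 0 ![ex, ey])
    (hb₃ : b₃ = (1 / 2) * iteratedFDeriv ℝ 2 f 0 ![ey, ey])
    (hc₁ : c₁ = (1 / 6) * iteratedFDeriv ℝ 3 f 0 ![ex, ex, ex])
    (hc₂ : c₂ = (1 / 2) * iteratedFDeriv ℝ 3 f 0 ![ex, ex, ey])
    (hc₃ : c₃ = (1 / 2) * iteratedFDeriv ℝ 3 f 0 ![ex, ey, ey])
    (hc₄ : c₄ = (1 / 6) * iteratedFDeriv ℝ 3 f 0 ![ey, ey, ey])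
    (hd₁ : d₁ = (1 / 24) * iteratedFDeriv ℝ 4 f 0 ![ex, ex, ex, ex])
    (hd₂ : d₂ = (1 / 6) * iteratedFDeriv ℝ 4 f 0 ![ex, ex, ex, ey])
    (hd₃ : d₃ = (1 / 4) * iteratedFDeriv ℝ 4 f 0 ![ex, ex, ey, ey])
    (hd₄ : d₄ = (1 / 6) * iteratedFDeriv ℝ 4 f 0 ![ex, ey, ey, ey])
    (hd₅ : d₅ = (1 / 24) * iteratedFDeriv ℝ 4 f 0 ![ey, ey, ey, ey]) (R : ℝ) :
    ∃ C : ℝ, 0 ≤ C ∧ ∀ x y : ℝ, ‖x • ex + y • ey‖ ≤ R →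
      |f (x • ex + y • ey) - ((b₁ * x ^ 2 + b₂ * x * y + b₃ * y ^ 2)
        + (c₁ * x ^ 3 + c₂ * x ^ 2 * y + c₃ * x * y ^ 2 + c₄ * y ^ 3)
        + (d₁ * x ^ 4 + d₂ * x ^ 3 * y + d₃ * x ^ 2 * y ^ 2 + d₄ * x * y ^ 3 + d₅ * y ^ 4))|
        ≤ C * ‖x • ex + y • ey‖ ^ 5 ∧
      |D ex f (x • ex + y • ey) - ((2 * b₁ * x + b₂ * y)
        + (3 * c₁ * x ^ 2 + 2 * c₂ * x * y + c₃ * y ^ 2)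
        + (4 * d₁ * x ^ 3 + 3 * d₂ * x ^ 2 * y + 2 * d₃ * x * y ^ 2 + d₄ * y ^ 3))|
        ≤ C * ‖x • ex + y • ey‖ ^ 4 ∧
      |D ey f (x • ex + y • ey) - ((b₂ * x + 2 * b₃ * y)
        + (c₂ * x ^ 2 + 2 * c₃ * x * y + 3 * c₄ * y ^ 2)
        + (d₂ * x ^ 3 + 2 * d₃ * x ^ 2 * y + 3 * d₄ * x * y ^ 2 + 4 * d₅ * y ^ 3))|
        ≤ C * ‖x • ex + y • ey‖ ^ 4 := by
  have hX := D_smooth hf ex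
  have hY := D_smooth hf ey
  have hXX := D_smooth hX ex
  have hXY := D_smooth hX ey
  have hYY := D_smooth hY ey
  have cXY : D ex (D ey f) = D ey (D ex f) := D_comm hf ex ey
  have cX := D_comm hX ex ey
  have cY := D_comm hY ex ey
  have hXXX := D_smooth hXX ex
  have hXXY := D_smooth hXX ey
  have hXYY := D_smooth hXY ey
  have hYYY := D_smooth hYY ey
  have cXX := D_comm hXX ex ey
  have cXY2 := D_comm hXY ex ey
  have cYY := D_comm hYY ex ey
  rw [itf2 hf] at hb₁ hb₂ hb₃
  rw [itf3 hf] at hc₁ hc₂ hc₃ hc₄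
  rw [itf4 hf] at hd₁ hd₂ hd₃ hd₄ hd₅
  simp [cXY, cX, cY, cXX, cXY2, cYY] at hb₁ hb₂ hb₃ hc₁ hc₂ hc₃ hc₄ hd₁ hd₂ hd₃ hd₄ hd₅
  obtain ⟨C1, h10, h1⟩ := taylor_bound hf 4 R
  obtain ⟨C2, h20, h2⟩ := taylor_bound hX 3 R
  obtain ⟨C3, h30, h3⟩ := taylor_bound hY 3 R
  refine ⟨C1 + C2 + C3, by positivity, fun x y hw => ⟨?_, ?_, ?_⟩⟩
  · refine le_trans (le_of_eq ?_) ((h1 _ hw).trans (by gcongr; linarith))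
    congr 2
    simp only [Finset.sum_range_succ, Finset.sum_range_zero, iteratedFDeriv_zero_apply,
      itf1 hf, itf2 hf, itf3 hf, itf4 hf, D_w2 hf, D_w3 hf, D_w4 hf, D_w1 f,
      hf0, hx0, hy0, hb₁, hb₂, hb₃, hc₁, hc₂, hc₃, hc₄, hd₁, hd₂, hd₃, hd₄, hd₅]
    simp [Nat.factorial]
    ring
  · refine le_trans (le_of_eq ?_) ((h2 _ hw).trans (by gcongr; linarith))
    congr 2
    simp only [Finset.sum_range_succ, Finset.sum_range_zero, iteratedFDeriv_zero_apply,
      itf1 hX, itf2 hX, itf3 hX, D_w2 hX, D_w3 hX, D_w1 (D ex f),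
      hf0, hx0, hy0, hb₁, hb₂, hb₃, hc₁, hc₂, hc₃, hc₄, hd₁, hd₂, hd₃, hd₄, hd₅, cXY, cX, cY, cXX, cXY2, cYY]
    simp [Nat.factorial]
    ring
  · refine le_trans (le_of_eq ?_) ((h3 _ hw).trans (by gcongr; linarith))
    congr 2
    simp only [Finset.sum_range_succ, Finset.sum_range_zero, iteratedFDeriv_zero_apply,
      itf1 hY, itf2 hY, itf3 hY, D_w2 hY, D_w3 hY, D_w1 (D ey f),
      hf0, hx0, hy0, hb₁, hb₂, hb₃, hc₁, hc₂, hc₃, hc₄, hd₁, hd₂, hd₃, hd₄, hd₅, cXY, cX, cY, cXX, cXY2, cYY]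
    simp [Nat.factorial]
    ring

end Bry

namespace Bry
open Asymptotics Topology

lemma mellin_cont (A : ℝ → ℂ) (hA : LocallyIntegrableOn A (Set.Ioi 0)) (R : ℝ)
    (hR : ∀ r, R < r → A r = 0) (A0 A2 A4 : ℂ)
    (h0 : (fun r : ℝ => A r - (A0 + A2 * (r : ℂ) ^ 2 + A4 * (r : ℂ) ^ 4))
      =O[𝓝[>] (0 : ℝ)] fun r => r ^ 5) :
    ∃ G : ℂ → ℂ, (∀ s : ℂ, -2 < s.re → G s = mellin A (s + 2)) ∧
      (∀ s : ℂ, -7 < s.re → s ≠ -2 → s ≠ -4 → s ≠ -6 → DifferentiableAt ℂ G s) ∧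
      Tendsto (fun s : ℂ => (s + 6) * G s) (𝓝[≠] (-6 : ℂ)) (𝓝 A4) := by
  set I : ℕ → ℝ → ℂ := fun k => Set.indicator (Set.Ioc 0 1) (fun t => (t : ℂ) ^ (k : ℂ)) with hI
  have hIloc : ∀ k, LocallyIntegrableOn (I k) (Set.Ioi 0) := by
    intro k
    have h1 : Integrable (I k) := by
      rw [hI]
      rw [integrable_indicator_iff measurableSet_Ioc]
      have : Continuous (fun t : ℝ => (t : ℂ) ^ (k : ℂ)) := by
        simp only [cpow_natCast]; fun_prop
      exact this.continuousOn.integrableOn_Icc.mono_set Set.Ioc_subset_Icc_self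
    exact h1.locallyIntegrable.locallyIntegrableOn _
  set Q : ℝ → ℂ := fun r => A0 * I 0 r + A2 * I 2 r + A4 * I 4 r with hQ
  set A' : ℝ → ℂ := fun r => A r - Q r with hA'
  have hQloc : LocallyIntegrableOn Q (Set.Ioi 0) := by
    exact (((hIloc 0).smul A0).add ((hIloc 2).smul A2)).add ((hIloc 4).smul A4)
  have hA'loc : LocallyIntegrableOn A' (Set.Ioi 0) := hA.sub hQloc
  have hI1 : ∀ k, ∀ t, 1 < t → I k t = 0 := by
    intro k t ht
    simp [hI, ht]
  have htop : ∀ a : ℝ, A' =O[atTop] (fun t : ℝ => t ^ (-a)) := by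
    intro a
    have : A' =ᶠ[atTop] (fun _ => (0 : ℂ)) := by
      filter_upwards [eventually_gt_atTop R, eventually_gt_atTop 1] with t ht ht1
      simp [hA', hQ, hR t ht, hI1 _ t ht1]
    exact this.trans_isBigO (isBigO_zero _ _)
  have hbot : A' =O[𝓝[>] 0] (fun t : ℝ => t ^ (-(-5 : ℝ))) := by
    have e1 : A' =ᶠ[𝓝[>] 0] (fun r : ℝ => A r - (A0 + A2 * (r : ℂ) ^ 2 + A4 * (r : ℂ) ^ 4)) := by
      filter_upwards [Ioc_mem_nhdsGT (zero_lt_one' ℝ)] with t ht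
      simp only [hA', hQ, hI, Set.indicator_of_mem ht, cpow_natCast]
      simp
    refine e1.trans_isBigO (h0.trans_eventuallyEq ?_)
    filter_upwards with t
    rw [neg_neg]
    norm_cast
  have hAtop : ∀ a : ℝ, A =O[atTop] (fun t : ℝ => t ^ (-a)) := by
    intro a
    have : A =ᶠ[atTop] (fun _ => (0 : ℂ)) := by
      filter_upwards [eventually_gt_atTop R] with t ht
      simp [hR t ht]
    exact this.trans_isBigO (isBigO_zero _ _)
  have hdiff : ∀ s : ℂ, -7 < s.re → DifferentiableAt ℂ (fun s => mellin A' (s + 2)) s := by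
    intro s hs
    have : DifferentiableAt ℂ (mellin A') (s + 2) :=
      mellin_differentiableAt_of_isBigO_rpow hA'loc (htop ((s+2).re + 1)) (by linarith) hbot
        (by simp; linarith)
    exact DifferentiableAt.comp (g := mellin A') (f := fun s : ℂ => s + 2) s this (by fun_prop)
  refine ⟨fun s => mellin A' (s + 2) + A0 / (s + 2) + A2 / (s + 4) + A4 / (s + 6), ?_, ?_, ?_⟩
  · intro s hs
    have hm : ∀ k : ℕ, HasMellin (I k) (s + 2) (1 / (s + 2 + k)) := by
      intro k
      apply hasMellin_cpow_Ioc
      simp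
      have : (0:ℝ) ≤ k := by positivity
      linarith
    have hc' : MellinConvergent A' (s + 2) :=
      mellinConvergent_of_isBigO_rpow hA'loc (htop ((s+2).re + 1)) (by linarith) hbot
        (by simp; linarith)
    have m := fun (a : ℂ) (k : ℕ) => hasMellin_const_smul (hm k).1 a
    have m1 := hasMellin_add (m A0 0).1 (m A2 2).1
    have m2 := hasMellin_add m1.1 (m A4 4).1
    have m3 := hasMellin_add hc' m2.1
    have h2 : A = fun t => A' t + (A0 • I 0 t + A2 • I 2 t + A4 • I 4 t) := by
      funext t; simp [hA', hQ]
    rw [h2, m3.2, m2.2, m1.2, (m A0 0).2, (m A2 2).2, (m A4 4).2, (hm 0).2, (hm 2).2, (hm 4).2]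
    simp only [smul_eq_mul]
    push_cast
    rw [show s + 4 = s + 2 + 2 by ring, show s + 6 = s + 2 + 4 by ring]
    ring
  · intro s hs h2 h4 h6
    have h2' : s + 2 ≠ 0 := fun h => h2 (by linear_combination h)
    have h4' : s + 4 ≠ 0 := fun h => h4 (by linear_combination h)
    have h6' : s + 6 ≠ 0 := fun h => h6 (by linear_combination h)
    have := hdiff s hs
    fun_prop (disch := assumption)
  · have hc : ContinuousAt (fun s : ℂ => (s + 6) * (mellin A' (s + 2) + A0 / (s + 2) + A2 / (s + 4))
        + A4) (-6) := by
      have := (hdiff (-6) (by simp; norm_num)).continuousAt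
      have e2 : (-6 + 2 : ℂ) ≠ 0 := by norm_num
      have e4 : (-6 + 4 : ℂ) ≠ 0 := by norm_num
      fun_prop (disch := assumption)
    have ht := hc.tendsto.mono_left (nhdsWithin_le_nhds (s := {(-6:ℂ)}ᶜ))
    simp only [neg_add_cancel, zero_mul, zero_add] at ht
    refine ht.congr' ?_
    filter_upwards [self_mem_nhdsWithin] with s hs
    have h6' : s + 6 ≠ 0 := fun h => hs (by rw [Set.mem_singleton_iff]; linear_combination h)
    field_simp

/-- Holomorphy of dominated parametric integrals. -/
lemma hol_int {α : Type*} [MeasurableSpace α] (μ : Measure α) (G : ℂ → α → ℂ) (s₀ : ℂ) (ε : ℝ)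
    (hε : 0 < ε) (bound : α → ℝ) (hbi : Integrable bound μ)
    (hm : ∀ s, AEStronglyMeasurable (G s) μ)
    (hd : ∀ᵐ a ∂μ, Differentiable ℂ (fun s => G s a))
    (hb : ∀ᵐ a ∂μ, ∀ s ∈ Metric.ball s₀ ε, ‖G s a‖ ≤ bound a) :
    DifferentiableAt ℂ (fun s => ∫ a, G s a ∂μ) s₀ := by
  have hmeas' : AEStronglyMeasurable (fun a => deriv (fun s => G s a) s₀) μ := by
    refine aestronglyMeasurable_of_tendsto_ae atTop
      (f := fun (n : ℕ) a => ((1 / ((n : ℂ) + 1)))⁻¹ • (G (s₀ + 1 / ((n : ℂ) + 1)) a - G s₀ a))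
      (fun n => by exact ((hm (s₀ + 1 / ((n : ℂ) + 1))).sub (hm s₀)).const_smul ((1 / ((n : ℂ) + 1))⁻¹)) ?_
    filter_upwards [hd] with a hda
    have h1 : HasDerivAt (fun s => G s a) (deriv (fun s => G s a) s₀) s₀ :=
      (hda s₀).hasDerivAt
    have h2 := h1.tendsto_slope_zero
    refine h2.comp (f := fun n : ℕ => 1 / ((n : ℂ) + 1)) (tendsto_nhdsWithin_iff.2 ⟨?_, ?_⟩)
    · exact tendsto_one_div_add_atTop_nhds_zero_nat (𝕜 := ℂ)
    · filter_upwards with n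
      have : (n : ℂ) + 1 ≠ 0 := by exact_mod_cast Nat.succ_ne_zero n
      simp [this]
  refine (hasDerivAt_integral_of_dominated_loc_of_deriv_le (F := G) (bound := fun a => bound a / (ε / 2 / 2))
    (F' := fun s a => deriv (fun s => G s a) s) (s := Metric.ball s₀ (ε / 2)) (Metric.ball_mem_nhds _ (by positivity))
    (Eventually.of_forall hm) ?_ hmeas' ?_ (hbi.div_const _) ?_).2.differentiableAt
  · refine hbi.mono' (hm _) ?_
    filter_upwards [hb] with a ha
    exact ha _ (Metric.mem_ball_self hε)
  · filter_upwards [hb, hd] with a ha hda s hs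
    apply Complex.norm_deriv_le_of_forall_mem_sphere_norm_le (by positivity)
    · exact hda.diffContOnCl
    · intro z hz
      apply ha
      rw [Metric.mem_ball] at hs ⊢
      rw [Metric.mem_sphere] at hz
      have := dist_triangle z s s₀
      linarith
  · filter_upwards [hd] with a hda s _
    exact (hda s).hasDerivAt

/-- Moments of the circle. -/
lemma trig_rec (a b : ℕ) :
    ((b : ℝ) + 1) * ∫ t in (-Real.pi)..Real.pi, Real.cos t ^ (a + 2) * Real.sin t ^ b =
    ((a : ℝ) + 1) * ∫ t in (-Real.pi)..Real.pi, Real.cos t ^ a * Real.sin t ^ (b + 2) := by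
  have h : ∀ t ∈ Set.uIcc (-Real.pi) Real.pi,
      HasDerivAt (fun t => Real.cos t ^ (a + 1) * Real.sin t ^ (b + 1))
      (((b : ℝ) + 1) * (Real.cos t ^ (a + 2) * Real.sin t ^ b)
        - ((a : ℝ) + 1) * (Real.cos t ^ a * Real.sin t ^ (b + 2))) t := by
    intro t _
    have := ((Real.hasDerivAt_cos t).pow (a + 1)).mul ((Real.hasDerivAt_sin t).pow (b + 1))
    refine this.congr_deriv ?_
    simp
    ring
  have h2 := intervalIntegral.integral_eq_sub_of_hasDerivAt h
    (by apply Continuous.intervalIntegrable; fun_prop)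
  rw [intervalIntegral.integral_sub (by apply Continuous.intervalIntegrable; fun_prop)
    (by apply Continuous.intervalIntegrable; fun_prop), intervalIntegral.integral_const_mul,
    intervalIntegral.integral_const_mul] at h2
  simp at h2
  linarith

lemma trig_add (a b : ℕ) :
    (∫ t in (-Real.pi)..Real.pi, Real.cos t ^ (a + 2) * Real.sin t ^ b) +
    (∫ t in (-Real.pi)..Real.pi, Real.cos t ^ a * Real.sin t ^ (b + 2)) =
    ∫ t in (-Real.pi)..Real.pi, Real.cos t ^ a * Real.sin t ^ b := by
  rw [← intervalIntegral.integral_add (by apply Continuous.intervalIntegrable; fun_prop)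
    (by apply Continuous.intervalIntegrable; fun_prop)]
  congr 1; funext t
  linear_combination (Real.cos t ^ a * Real.sin t ^ b) * Real.sin_sq_add_cos_sq t

lemma trig_left (a b : ℕ) :
    (∫ t in (-Real.pi)..Real.pi, Real.cos t ^ (a + 2) * Real.sin t ^ b) = ((a : ℝ) + 1) / (a + b + 2) *
    ∫ t in (-Real.pi)..Real.pi, Real.cos t ^ a * Real.sin t ^ b := by
  have h1 := trig_rec a b
  have h2 := trig_add a b
  have : (a : ℝ) + b + 2 ≠ 0 := by positivity
  field_simp
  linear_combination h1 + (a + 1 : ℝ) * h2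

lemma trig_right (a b : ℕ) :
    (∫ t in (-Real.pi)..Real.pi, Real.cos t ^ a * Real.sin t ^ (b + 2)) = ((b : ℝ) + 1) / (a + b + 2) *
    ∫ t in (-Real.pi)..Real.pi, Real.cos t ^ a * Real.sin t ^ b := by
  have h1 := trig_rec a b
  have h2 := trig_add a b
  have : (a : ℝ) + b + 2 ≠ 0 := by positivity
  field_simp
  linear_combination -h1 + (b + 1 : ℝ) * h2

lemma trig00 : (∫ t in (-Real.pi)..Real.pi, Real.cos t ^ 0 * Real.sin t ^ 0) = 2 * Real.pi := by
  simp; ring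
lemma trig01 : (∫ t in (-Real.pi)..Real.pi, Real.cos t ^ 0 * Real.sin t ^ 1) = 0 := by
  simp
lemma trig10 : (∫ t in (-Real.pi)..Real.pi, Real.cos t ^ 1 * Real.sin t ^ 0) = 0 := by
  simp
lemma trig11 : (∫ t in (-Real.pi)..Real.pi, Real.cos t ^ 1 * Real.sin t ^ 1) = 0 := by
  have := integral_sin_mul_cos₁ (a := -Real.pi) (b := Real.pi)
  simp only [pow_one]
  simp_rw [mul_comm (Real.cos _)]
  rw [this]; simp

lemma trig_sum (n : ℕ) (p : ℕ → ℝ) :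
    (∫ t in (-Real.pi)..Real.pi, ∑ i ∈ Finset.range (n + 1), p i * (Real.cos t ^ (n - i) * Real.sin t ^ i))
     = ∑ i ∈ Finset.range (n + 1), p i * ∫ t in (-Real.pi)..Real.pi, Real.cos t ^ (n - i) * Real.sin t ^ i := by
  rw [intervalIntegral.integral_finsetSum]
  · simp_rw [intervalIntegral.integral_const_mul]
  · intro i _
    apply Continuous.intervalIntegrable; fun_prop


lemma anti_int (h : ℝ → ℝ) (hc : Continuous h) (ha : ∀ t, h (t + Real.pi) = - h t) :
    ∫ t in (-Real.pi)..Real.pi, h t = 0 := by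
  have h1 := intervalIntegral.integral_comp_add_right h Real.pi (a := -Real.pi) (b := 0)
  simp only [ha, neg_add_cancel, zero_add, intervalIntegral.integral_neg] at h1
  rw [← intervalIntegral.integral_add_adjacent_intervals (b := 0)
    (hc.intervalIntegrable _ _) (hc.intervalIntegrable _ _), ← h1]
  ring

section
variable (b₁ b₂ b₃ c₁ c₂ c₃ c₄ d₁ d₂ d₃ d₄ d₅ x y : ℝ)
noncomputable def fB : ℝ := b₁ * x ^ 2 + b₂ * x * y + b₃ * y ^ 2
noncomputable def fC : ℝ := c₁ * x ^ 3 + c₂ * x ^ 2 * y + c₃ * x * y ^ 2 + c₄ * y ^ 3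
noncomputable def fD : ℝ := d₁ * x ^ 4 + d₂ * x ^ 3 * y + d₃ * x ^ 2 * y ^ 2 + d₄ * x * y ^ 3 + d₅ * y ^ 4
noncomputable def fBx : ℝ := 2 * b₁ * x + b₂ * y
noncomputable def fCx : ℝ := 3 * c₁ * x ^ 2 + 2 * c₂ * x * y + c₃ * y ^ 2
noncomputable def fDx : ℝ := 4 * d₁ * x ^ 3 + 3 * d₂ * x ^ 2 * y + 2 * d₃ * x * y ^ 2 + d₄ * y ^ 3
noncomputable def fBy : ℝ := b₂ * x + 2 * b₃ * y
noncomputable def fCy : ℝ := c₂ * x ^ 2 + 2 * c₃ * x * y + 3 * c₄ * y ^ 2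
noncomputable def fDy : ℝ := d₂ * x ^ 3 + 2 * d₃ * x ^ 2 * y + 3 * d₄ * x * y ^ 2 + 4 * d₅ * y ^ 3

/-- Total degree four coefficient of the integrand at `s = -6`. -/
noncomputable def tot : ℝ :=
  -3 * (fC c₁ c₂ c₃ c₄ x y ^ 2 + 2 * fB b₁ b₂ b₃ x y * fD d₁ d₂ d₃ d₄ d₅ x y)
  + 6 * fB b₁ b₂ b₃ x y ^ 4
  - 3 / 2 * fB b₁ b₂ b₃ x y ^ 2 * (fBx b₁ b₂ x y ^ 2 + fBy b₂ b₃ x y ^ 2)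
  + 1 / 2 * (fCx c₁ c₂ c₃ x y ^ 2 + fCy c₂ c₃ c₄ x y ^ 2
    + 2 * (fBx b₁ b₂ x y * fDx d₁ d₂ d₃ d₄ x y + fBy b₂ b₃ x y * fDy d₂ d₃ d₄ d₅ x y))
  - 1 / 8 * (fBx b₁ b₂ x y ^ 2 + fBy b₂ b₃ x y ^ 2) ^ 2
end

lemma trig4 (p0 p1 p2 p3 p4 : ℝ) :
    (∫ t in (-Real.pi)..Real.pi, (p0 * (Real.cos t ^ 4 * Real.sin t ^ 0) + p1 * (Real.cos t ^ 3 * Real.sin t ^ 1)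
     + p2 * (Real.cos t ^ 2 * Real.sin t ^ 2) + p3 * (Real.cos t ^ 1 * Real.sin t ^ 3)
     + p4 * (Real.cos t ^ 0 * Real.sin t ^ 4)))
     = Real.pi / 4 * (3 * p0 + p2 + 3 * p4) := by
  have h := trig_sum 4 (fun i => [p0, p1, p2, p3, p4].getD i 0)
  simp only [Finset.sum_range_succ, Finset.sum_range_zero, Nat.reduceSub, Nat.reduceAdd, List.getD_cons_zero, List.getD_cons_succ, zero_add] at h
  rw [h]
  simp only [trig_left _ _, trig_right _ _]
  simp only [trig00, trig11]
  push_cast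
  ring

lemma trig6 (p0 p1 p2 p3 p4 p5 p6 : ℝ) :
    (∫ t in (-Real.pi)..Real.pi, (p0 * (Real.cos t ^ 6 * Real.sin t ^ 0) + p1 * (Real.cos t ^ 5 * Real.sin t ^ 1) + p2 * (Real.cos t ^ 4 * Real.sin t ^ 2) + p3 * (Real.cos t ^ 3 * Real.sin t ^ 3)
      + p4 * (Real.cos t ^ 2 * Real.sin t ^ 4) + p5 * (Real.cos t ^ 1 * Real.sin t ^ 5) + p6 * (Real.cos t ^ 0 * Real.sin t ^ 6)))
     = 2 * Real.pi / 48 * (15 * p0 + 3 * p2 + 3 * p4 + 15 * p6) := by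
  have h := trig_sum 6 (fun i => [p0, p1, p2, p3, p4, p5, p6].getD i 0)
  simp only [Finset.sum_range_succ, Finset.sum_range_zero, Nat.reduceSub, Nat.reduceAdd, List.getD_cons_zero, List.getD_cons_succ, zero_add] at h
  rw [h]
  simp only [trig_left _ _, trig_right _ _]
  simp only [trig00, trig11]
  push_cast
  ring

lemma trig8 (p0 p1 p2 p3 p4 p5 p6 p7 p8 : ℝ) :
    (∫ t in (-Real.pi)..Real.pi, (p0 * (Real.cos t ^ 8 * Real.sin t ^ 0) + p1 * (Real.cos t ^ 7 * Real.sin t ^ 1) + p2 * (Real.cos t ^ 6 * Real.sin t ^ 2) + p3 * (Real.cos t ^ 5 * Real.sin t ^ 3)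
      + p4 * (Real.cos t ^ 4 * Real.sin t ^ 4) + p5 * (Real.cos t ^ 3 * Real.sin t ^ 5) + p6 * (Real.cos t ^ 2 * Real.sin t ^ 6) + p7 * (Real.cos t ^ 1 * Real.sin t ^ 7) + p8 * (Real.cos t ^ 0 * Real.sin t ^ 8)))
     = 2 * Real.pi / 384 * (105 * p0 + 15 * p2 + 9 * p4 + 15 * p6 + 105 * p8) := by
  have h := trig_sum 8 (fun i => [p0, p1, p2, p3, p4, p5, p6, p7, p8].getD i 0)
  simp only [Finset.sum_range_succ, Finset.sum_range_zero, Nat.reduceSub, Nat.reduceAdd, List.getD_cons_zero, List.getD_cons_succ, zero_add] at h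
  rw [h]
  simp only [trig_left _ _, trig_right _ _]
  simp only [trig00, trig11]
  push_cast
  ring

lemma tot_eq (b₁ b₂ b₃ c₁ c₂ c₃ c₄ d₁ d₂ d₃ d₄ d₅ X Y : ℝ) :
    tot b₁ b₂ b₃ c₁ c₂ c₃ c₄ d₁ d₂ d₃ d₄ d₅ X Y =
    (((9/2) * c₁ ^ 2 + (1/2) * c₂ ^ 2 + (8) * b₁ * d₁ + (1) * b₂ * d₂ + (-2) * b₁ ^ 4 + (-1) * b₁ ^ 2 * b₂ ^ 2 + (-1/8) * b₂ ^ 4) * (X ^ 4 * Y ^ 0)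
      + ((6) * c₁ * c₂ + (2) * c₂ * c₃ + (6) * b₁ * d₂ + (4) * b₂ * d₁ + (2) * b₂ * d₃ + (2) * b₃ * d₂ + (-4) * b₁ ^ 3 * b₂ + (-4) * b₁ ^ 2 * b₂ * b₃ + (-1) * b₁ * b₂ ^ 3 + (-1) * b₂ ^ 3 * b₃) * (X ^ 3 * Y ^ 1)
      + ((3) * c₁ * c₃ + (2) * c₂ ^ 2 + (3) * c₂ * c₄ + (2) * c₃ ^ 2 + (4) * b₁ * d₃ + (3) * b₂ * d₂ + (3) * b₂ * d₄ + (4) * b₃ * d₃ + (-3) * b₁ ^ 2 * b₂ ^ 2 + (-4) * b₁ ^ 2 * b₃ ^ 2 + (-4) * b₁ * b₂ ^ 2 * b₃ + (-1/4) * b₂ ^ 4 + (-3) * b₂ ^ 2 * b₃ ^ 2) * (X ^ 2 * Y ^ 2)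
      + ((2) * c₂ * c₃ + (6) * c₃ * c₄ + (2) * b₁ * d₄ + (2) * b₂ * d₃ + (4) * b₂ * d₅ + (6) * b₃ * d₄ + (-1) * b₁ * b₂ ^ 3 + (-4) * b₁ * b₂ * b₃ ^ 2 + (-1) * b₂ ^ 3 * b₃ + (-4) * b₂ * b₃ ^ 3) * (X ^ 1 * Y ^ 3)
      + ((1/2) * c₃ ^ 2 + (9/2) * c₄ ^ 2 + (1) * b₂ * d₄ + (8) * b₃ * d₅ + (-1/8) * b₂ ^ 4 + (-1) * b₂ ^ 2 * b₃ ^ 2 + (-2) * b₃ ^ 4) * (X ^ 0 * Y ^ 4))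
    + (((-3) * c₁ ^ 2 + (-6) * b₁ * d₁ + (-6) * b₁ ^ 4 + (-3/2) * b₁ ^ 2 * b₂ ^ 2) * (X ^ 6 * Y ^ 0)
      + ((-6) * c₁ * c₂ + (-6) * b₁ * d₂ + (-6) * b₂ * d₁ + (-18) * b₁ ^ 3 * b₂ + (-6) * b₁ ^ 2 * b₂ * b₃ + (-3) * b₁ * b₂ ^ 3) * (X ^ 5 * Y ^ 1)
      + ((-6) * c₁ * c₃ + (-3) * c₂ ^ 2 + (-6) * b₁ * d₃ + (-6) * b₂ * d₂ + (-6) * b₃ * d₁ + (-39/2) * b₁ ^ 2 * b₂ ^ 2 + (-6) * b₁ ^ 2 * b₃ ^ 2 + (-15) * b₁ * b₂ ^ 2 * b₃ + (-12) * b₁ ^ 3 * b₃ + (-3/2) * b₂ ^ 4) * (X ^ 4 * Y ^ 2)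
      + ((-6) * c₁ * c₄ + (-6) * c₂ * c₃ + (-6) * b₁ * d₄ + (-6) * b₂ * d₃ + (-6) * b₃ * d₂ + (-9) * b₁ * b₂ ^ 3 + (-24) * b₁ * b₂ * b₃ ^ 2 + (-24) * b₁ ^ 2 * b₂ * b₃ + (-9) * b₂ ^ 3 * b₃) * (X ^ 3 * Y ^ 3)
      + ((-6) * c₂ * c₄ + (-3) * c₃ ^ 2 + (-6) * b₁ * d₅ + (-6) * b₂ * d₄ + (-6) * b₃ * d₃ + (-15) * b₁ * b₂ ^ 2 * b₃ + (-12) * b₁ * b₃ ^ 3 + (-3/2) * b₂ ^ 4 + (-39/2) * b₂ ^ 2 * b₃ ^ 2 + (-6) * b₁ ^ 2 * b₃ ^ 2) * (X ^ 2 * Y ^ 4)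
      + ((-6) * c₃ * c₄ + (-6) * b₂ * d₅ + (-6) * b₃ * d₄ + (-3) * b₂ ^ 3 * b₃ + (-18) * b₂ * b₃ ^ 3 + (-6) * b₁ * b₂ * b₃ ^ 2) * (X ^ 1 * Y ^ 5)
      + ((-3) * c₄ ^ 2 + (-6) * b₃ * d₅ + (-3/2) * b₂ ^ 2 * b₃ ^ 2 + (-6) * b₃ ^ 4) * (X ^ 0 * Y ^ 6))
    + (((6) * b₁ ^ 4) * (X ^ 8 * Y ^ 0)
      + ((24) * b₁ ^ 3 * b₂) * (X ^ 7 * Y ^ 1)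
      + ((24) * b₁ ^ 3 * b₃ + (36) * b₁ ^ 2 * b₂ ^ 2) * (X ^ 6 * Y ^ 2)
      + ((72) * b₁ ^ 2 * b₂ * b₃ + (24) * b₁ * b₂ ^ 3) * (X ^ 5 * Y ^ 3)
      + ((36) * b₁ ^ 2 * b₃ ^ 2 + (72) * b₁ * b₂ ^ 2 * b₃ + (6) * b₂ ^ 4) * (X ^ 4 * Y ^ 4)
      + ((72) * b₁ * b₂ * b₃ ^ 2 + (24) * b₂ ^ 3 * b₃) * (X ^ 3 * Y ^ 5)
      + ((24) * b₁ * b₃ ^ 3 + (36) * b₂ ^ 2 * b₃ ^ 2) * (X ^ 2 * Y ^ 6)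
      + ((24) * b₂ * b₃ ^ 3) * (X ^ 1 * Y ^ 7)
      + ((6) * b₃ ^ 4) * (X ^ 0 * Y ^ 8)) := by
  unfold tot fB fC fD fBx fBy fCx fCy fDx fDy
  ring

lemma trig_final (b₁ b₂ b₃ c₁ c₂ c₃ c₄ d₁ d₂ d₃ d₄ d₅ : ℝ) :
    (∫ t in (-Real.pi)..Real.pi, tot b₁ b₂ b₃ c₁ c₂ c₃ c₄ d₁ d₂ d₃ d₄ d₅ (Real.cos t) (Real.sin t)) = Real.pi / 32 *
          (72 * b₃ * d₅ - 24 * b₁ * d₅ + 24 * b₂ * d₄ + 48 * c₄ ^ 2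
            + 8 * b₃ * d₃ + 8 * b₁ * d₃ + 16 * c₃ ^ 2 - 63 * b₃ ^ 4
            + 12 * b₁ * b₃ ^ 3 - 66 * b₂ ^ 2 * b₃ ^ 2 - 26 * b₁ ^ 2 * b₃ ^ 2
            - 44 * b₁ * b₂ ^ 2 * b₃ - 24 * b₃ * d₁ + 12 * b₁ ^ 3 * b₃
            + 24 * b₂ * d₂ + 16 * c₂ ^ 2 - 11 * b₂ ^ 4 - 66 * b₁ ^ 2 * b₂ ^ 2
            + 72 * b₁ * d₁ + 48 * c₁ ^ 2 - 63 * b₁ ^ 4) := by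
  have h4 := trig4
    ((9/2) * c₁ ^ 2 + (1/2) * c₂ ^ 2 + (8) * b₁ * d₁ + (1) * b₂ * d₂ + (-2) * b₁ ^ 4 + (-1) * b₁ ^ 2 * b₂ ^ 2 + (-1/8) * b₂ ^ 4)
    ((6) * c₁ * c₂ + (2) * c₂ * c₃ + (6) * b₁ * d₂ + (4) * b₂ * d₁ + (2) * b₂ * d₃ + (2) * b₃ * d₂ + (-4) * b₁ ^ 3 * b₂ + (-4) * b₁ ^ 2 * b₂ * b₃ + (-1) * b₁ * b₂ ^ 3 + (-1) * b₂ ^ 3 * b₃)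
    ((3) * c₁ * c₃ + (2) * c₂ ^ 2 + (3) * c₂ * c₄ + (2) * c₃ ^ 2 + (4) * b₁ * d₃ + (3) * b₂ * d₂ + (3) * b₂ * d₄ + (4) * b₃ * d₃ + (-3) * b₁ ^ 2 * b₂ ^ 2 + (-4) * b₁ ^ 2 * b₃ ^ 2 + (-4) * b₁ * b₂ ^ 2 * b₃ + (-1/4) * b₂ ^ 4 + (-3) * b₂ ^ 2 * b₃ ^ 2)
    ((2) * c₂ * c₃ + (6) * c₃ * c₄ + (2) * b₁ * d₄ + (2) * b₂ * d₃ + (4) * b₂ * d₅ + (6) * b₃ * d₄ + (-1) * b₁ * b₂ ^ 3 + (-4) * b₁ * b₂ * b₃ ^ 2 + (-1) * b₂ ^ 3 * b₃ + (-4) * b₂ * b₃ ^ 3)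
    ((1/2) * c₃ ^ 2 + (9/2) * c₄ ^ 2 + (1) * b₂ * d₄ + (8) * b₃ * d₅ + (-1/8) * b₂ ^ 4 + (-1) * b₂ ^ 2 * b₃ ^ 2 + (-2) * b₃ ^ 4)
  have h6 := trig6
    ((-3) * c₁ ^ 2 + (-6) * b₁ * d₁ + (-6) * b₁ ^ 4 + (-3/2) * b₁ ^ 2 * b₂ ^ 2)
    ((-6) * c₁ * c₂ + (-6) * b₁ * d₂ + (-6) * b₂ * d₁ + (-18) * b₁ ^ 3 * b₂ + (-6) * b₁ ^ 2 * b₂ * b₃ + (-3) * b₁ * b₂ ^ 3)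
    ((-6) * c₁ * c₃ + (-3) * c₂ ^ 2 + (-6) * b₁ * d₃ + (-6) * b₂ * d₂ + (-6) * b₃ * d₁ + (-39/2) * b₁ ^ 2 * b₂ ^ 2 + (-6) * b₁ ^ 2 * b₃ ^ 2 + (-15) * b₁ * b₂ ^ 2 * b₃ + (-12) * b₁ ^ 3 * b₃ + (-3/2) * b₂ ^ 4)
    ((-6) * c₁ * c₄ + (-6) * c₂ * c₃ + (-6) * b₁ * d₄ + (-6) * b₂ * d₃ + (-6) * b₃ * d₂ + (-9) * b₁ * b₂ ^ 3 + (-24) * b₁ * b₂ * b₃ ^ 2 + (-24) * b₁ ^ 2 * b₂ * b₃ + (-9) * b₂ ^ 3 * b₃)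
    ((-6) * c₂ * c₄ + (-3) * c₃ ^ 2 + (-6) * b₁ * d₅ + (-6) * b₂ * d₄ + (-6) * b₃ * d₃ + (-15) * b₁ * b₂ ^ 2 * b₃ + (-12) * b₁ * b₃ ^ 3 + (-3/2) * b₂ ^ 4 + (-39/2) * b₂ ^ 2 * b₃ ^ 2 + (-6) * b₁ ^ 2 * b₃ ^ 2)
    ((-6) * c₃ * c₄ + (-6) * b₂ * d₅ + (-6) * b₃ * d₄ + (-3) * b₂ ^ 3 * b₃ + (-18) * b₂ * b₃ ^ 3 + (-6) * b₁ * b₂ * b₃ ^ 2)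
    ((-3) * c₄ ^ 2 + (-6) * b₃ * d₅ + (-3/2) * b₂ ^ 2 * b₃ ^ 2 + (-6) * b₃ ^ 4)
  have h8 := trig8
    ((6) * b₁ ^ 4)
    ((24) * b₁ ^ 3 * b₂)
    ((24) * b₁ ^ 3 * b₃ + (36) * b₁ ^ 2 * b₂ ^ 2)
    ((72) * b₁ ^ 2 * b₂ * b₃ + (24) * b₁ * b₂ ^ 3)
    ((36) * b₁ ^ 2 * b₃ ^ 2 + (72) * b₁ * b₂ ^ 2 * b₃ + (6) * b₂ ^ 4)
    ((72) * b₁ * b₂ * b₃ ^ 2 + (24) * b₂ ^ 3 * b₃)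
    ((24) * b₁ * b₃ ^ 3 + (36) * b₂ ^ 2 * b₃ ^ 2)
    ((24) * b₂ * b₃ ^ 3)
    ((6) * b₃ ^ 4)
  have key : ∀ t, tot b₁ b₂ b₃ c₁ c₂ c₃ c₄ d₁ d₂ d₃ d₄ d₅ (Real.cos t) (Real.sin t) = _ + _ + _ := fun t =>
    tot_eq b₁ b₂ b₃ c₁ c₂ c₃ c₄ d₁ d₂ d₃ d₄ d₅ (Real.cos t) (Real.sin t)
  simp_rw [key]
  rw [intervalIntegral.integral_add (by apply Continuous.intervalIntegrable; fun_prop)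
    (by apply Continuous.intervalIntegrable; fun_prop), intervalIntegral.integral_add (by apply Continuous.intervalIntegrable; fun_prop)
    (by apply Continuous.intervalIntegrable; fun_prop), h4, h6, h8]
  ring

end Bry

namespace Bry
open Asymptotics Topology

/-- The filter `r → 0+`, uniformly in the angle. -/
noncomputable def lf : Filter (ℝ × ℝ) := 𝓝[>] (0 : ℝ) ×ˢ 𝓟 (Set.Icc (-Real.pi) Real.pi)

lemma lf_fst : Tendsto (fun p : ℝ × ℝ => p.1) lf (𝓝[>] 0) := tendsto_fst

lemma lf_fst0 : Tendsto (fun p : ℝ × ℝ => p.1) lf (𝓝 0) := lf_fst.mono_right nhdsWithin_le_nhds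

lemma lf_pos : ∀ᶠ p : ℝ × ℝ in lf, 0 < p.1 := lf_fst.eventually self_mem_nhdsWithin

lemma lf_lt {ε : ℝ} (hε : 0 < ε) : ∀ᶠ p : ℝ × ℝ in lf, p.1 < ε :=
  lf_fst0.eventually (gt_mem_nhds hε)

lemma lf_O1 {c : ℝ → ℝ} (hc : Continuous c) : (fun p : ℝ × ℝ => c p.2) =O[lf] (fun _ => (1 : ℝ)) := by
  obtain ⟨C, hC⟩ := (isCompact_Icc (a := -Real.pi) (b := Real.pi)).exists_bound_of_continuousOn
    hc.continuousOn
  refine IsBigO.of_bound C ?_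
  have h : ∀ᶠ p : ℝ × ℝ in lf, p.2 ∈ Set.Icc (-Real.pi) Real.pi :=
    (tendsto_snd (f := 𝓝[>] (0:ℝ)) (g := 𝓟 (Set.Icc (-Real.pi) Real.pi))).eventually
      (mem_principal_self _)
  filter_upwards [h] with p hp
  simpa using hC _ hp

lemma lf_pow {m n : ℕ} (h : n ≤ m) :
    (fun p : ℝ × ℝ => p.1 ^ m) =O[lf] (fun p => p.1 ^ n) := by
  refine IsBigO.of_bound 1 ?_
  filter_upwards [lf_pos, lf_lt one_pos] with p hp hp1
  rw [norm_pow, norm_pow, one_mul, Real.norm_of_nonneg hp.le]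
  exact pow_le_pow_of_le_one hp.le hp1.le h

lemma lf_mono {c : ℝ → ℝ} (hc : Continuous c) {m n : ℕ} (h : n ≤ m) :
    (fun p : ℝ × ℝ => c p.2 * p.1 ^ m) =O[lf] (fun p => p.1 ^ n) := by
  simpa using (lf_O1 hc).mul (lf_pow h)

/-- Expansion up to `O(r^5)` with no linear term. -/
structure X5 (a : ℝ × ℝ → ℝ) (c0 c2 c3 c4 : ℝ → ℝ) : Prop where
  h0 : Continuous c0
  h2 : Continuous c2
  h3 : Continuous c3
  h4 : Continuous c4
  h : (fun p : ℝ × ℝ => a p - (c0 p.2 + c2 p.2 * p.1 ^ 2 + c3 p.2 * p.1 ^ 3 + c4 p.2 * p.1 ^ 4))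
    =O[lf] (fun p => p.1 ^ 5)

lemma X5.poly {a : ℝ × ℝ → ℝ} {c0 c2 c3 c4 : ℝ → ℝ} (H : X5 a c0 c2 c3 c4) :
    (fun p : ℝ × ℝ => c0 p.2 + c2 p.2 * p.1 ^ 2 + c3 p.2 * p.1 ^ 3 + c4 p.2 * p.1 ^ 4)
    =O[lf] (fun p => p.1 ^ 0) := by
  refine ((IsBigO.add ?_ (lf_mono H.h2 (Nat.zero_le _))).add (lf_mono H.h3 (Nat.zero_le _))).add
    (lf_mono H.h4 (Nat.zero_le _))
  simpa using lf_O1 H.h0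

lemma X5.bdd {a : ℝ × ℝ → ℝ} {c0 c2 c3 c4 : ℝ → ℝ} (H : X5 a c0 c2 c3 c4) :
    a =O[lf] (fun p => p.1 ^ 0) := by
  have := (H.h.trans (lf_pow (Nat.zero_le 5))).add H.poly
  refine this.congr_left ?_
  intro p; ring

lemma X5.bdd2 {a : ℝ × ℝ → ℝ} {c2 c3 c4 : ℝ → ℝ} (H : X5 a (fun _ => 0) c2 c3 c4) :
    a =O[lf] (fun p => p.1 ^ 2) := by
  have h1 : (fun p : ℝ × ℝ => c2 p.2 * p.1 ^ 2 + c3 p.2 * p.1 ^ 3 + c4 p.2 * p.1 ^ 4)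
    =O[lf] (fun p => p.1 ^ 2) :=
    ((lf_mono H.h2 (by norm_num)).add (lf_mono H.h3 (by norm_num))).add (lf_mono H.h4 (by norm_num))
  have := (H.h.trans (lf_pow (n := 2) (by norm_num))).add h1
  refine this.congr_left ?_
  intro p; ring

lemma X5.mul {a a' : ℝ × ℝ → ℝ} {c0 c2 c3 c4 e0 e2 e3 e4 : ℝ → ℝ} (H : X5 a c0 c2 c3 c4)
    (H' : X5 a' e0 e2 e3 e4) :
    X5 (fun p => a p * a' p) (fun t => c0 t * e0 t) (fun t => c0 t * e2 t + c2 t * e0 t)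
      (fun t => c0 t * e3 t + c3 t * e0 t) (fun t => c0 t * e4 t + c2 t * e2 t + c4 t * e0 t) := by
  obtain ⟨h0, h2, h3, h4, h⟩ := id H
  obtain ⟨h0', h2', h3', h4', h'⟩ := id H'
  refine ⟨by fun_prop, by fun_prop, by fun_prop, by fun_prop, ?_⟩
  have t1 := (h.mul H'.bdd).congr_right (g₂ := fun p => p.1 ^ 5) (fun p => by ring)
  have t2 := (H.poly.mul h').congr_right (g₂ := fun p => p.1 ^ 5) (fun p => by ring)
  have t5 := lf_mono (c := fun t => c2 t * e3 t + c3 t * e2 t) (by fun_prop) (le_refl 5)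
  have t6 := lf_mono (c := fun t => c2 t * e4 t + c3 t * e3 t + c4 t * e2 t) (by fun_prop)
    (show 5 ≤ 6 by norm_num)
  have t7 := lf_mono (c := fun t => c3 t * e4 t + c4 t * e3 t) (by fun_prop) (show 5 ≤ 7 by norm_num)
  have t8 := lf_mono (c := fun t => c4 t * e4 t) (by fun_prop) (show 5 ≤ 8 by norm_num)
  refine (((((t1.add t2).add t5).add t6).add t7).add t8).congr_left ?_
  intro p; ring

lemma X5.of_eq {a a' : ℝ × ℝ → ℝ} {c0 c2 c3 c4 e0 e2 e3 e4 : ℝ → ℝ} (H : X5 a c0 c2 c3 c4)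
    (h : (fun p => a' p - a p) =O[lf] (fun p => p.1 ^ 5)) (h0 : ∀ t, c0 t = e0 t)
    (h2 : ∀ t, c2 t = e2 t) (h3 : ∀ t, c3 t = e3 t) (h4 : ∀ t, c4 t = e4 t) :
    X5 a' e0 e2 e3 e4 := by
  obtain rfl : c0 = e0 := funext h0
  obtain rfl : c2 = e2 := funext h2
  obtain rfl : c3 = e3 := funext h3
  obtain rfl : c4 = e4 := funext h4
  refine ⟨H.h0, H.h2, H.h3, H.h4, (H.h.add h).congr_left ?_⟩
  intro p; ring

lemma X5.lin {a a' : ℝ × ℝ → ℝ} {c0 c2 c3 c4 e0 e2 e3 e4 : ℝ → ℝ} (H : X5 a c0 c2 c3 c4)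
    (H' : X5 a' e0 e2 e3 e4) (x y : ℝ) :
    X5 (fun p => x * a p + y * a' p) (fun t => x * c0 t + y * e0 t) (fun t => x * c2 t + y * e2 t)
      (fun t => x * c3 t + y * e3 t) (fun t => x * c4 t + y * e4 t) := by
  obtain ⟨h0, h2, h3, h4, h⟩ := id H
  obtain ⟨h0', h2', h3', h4', h'⟩ := id H'
  refine ⟨by fun_prop, by fun_prop, by fun_prop, by fun_prop, ?_⟩
  refine ((h.const_mul_left x).add (h'.const_mul_left y)).congr_left ?_
  intro p; ring

lemma X5.one : X5 (fun _ => 1) (fun _ => 1) (fun _ => 0) (fun _ => 0) (fun _ => 0) := by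
  refine ⟨by fun_prop, by fun_prop, by fun_prop, by fun_prop, ?_⟩
  simpa using isBigO_zero _ _

lemma X5.sq_exp {u : ℝ × ℝ → ℝ} {α β γ : ℝ → ℝ} (hα : Continuous α) (hβ : Continuous β)
    (hγ : Continuous γ)
    (h : (fun p : ℝ × ℝ => u p - p.1 * (α p.2 + β p.2 * p.1 + γ p.2 * p.1 ^ 2))
      =O[lf] (fun p => p.1 ^ 4)) :
    X5 (fun p => u p ^ 2) (fun _ => 0) (fun t => α t ^ 2) (fun t => 2 * α t * β t)
      (fun t => β t ^ 2 + 2 * α t * γ t) := by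
  refine ⟨by fun_prop, by fun_prop, by fun_prop, by fun_prop, ?_⟩
  have hU : (fun p : ℝ × ℝ => p.1 * (α p.2 + β p.2 * p.1 + γ p.2 * p.1 ^ 2))
      =O[lf] (fun p => p.1 ^ 1) := by
    refine (((lf_mono hα (le_refl 1)).add (lf_mono hβ (show 1 ≤ 2 by norm_num))).add
      (lf_mono hγ (show 1 ≤ 3 by norm_num))).congr_left ?_
    intro p; ring
  have hu := (h.trans (lf_pow (n := 1) (by norm_num))).add (hU.const_mul_left 2)
  have t1 := (h.mul hu).congr_right (g₂ := fun p => p.1 ^ 5) (fun p => by ring)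
  have t5 := lf_mono (c := fun t => 2 * β t * γ t) (by fun_prop) (le_refl 5)
  have t6 := lf_mono (c := fun t => γ t ^ 2) (by fun_prop) (show 5 ≤ 6 by norm_num)
  refine ((t1.add t5).add t6).congr_left ?_
  intro p; ring

lemma X5.comp_aux {a : ℝ × ℝ → ℝ} {c2 c3 c4 : ℝ → ℝ} (H : X5 a (fun _ => 0) c2 c3 c4)
    (ha : ∀ p, 0 ≤ a p) (φ : ℝ → ℝ) (x y z C : ℝ)
    (hφ : ∀ t, 0 ≤ t → t ≤ 1 / 2 → |φ t - (x + y * t + z * t ^ 2)| ≤ C * t ^ 3) :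
    X5 (fun p => φ (a p)) (fun _ => x) (fun t => y * c2 t) (fun t => y * c3 t)
      (fun t => y * c4 t + z * c2 t ^ 2) := by
  have h1 := ((X5.one.lin H x y).lin (H.mul H) 1 z)
  refine h1.of_eq ?_ (by intro t; ring) (by intro t; ring) (by intro t; ring) (by intro t; ring)
  have hb := H.bdd2
  have ht : Tendsto a lf (𝓝 0) := by
    refine hb.trans_tendsto ?_
    simpa using lf_fst0.pow 2
  have h3 : (fun p => a p ^ 3) =O[lf] (fun p => p.1 ^ 5) := by
    have := (hb.pow 3).congr_right (g₂ := fun p => p.1 ^ 6) (fun p => by ring)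
    exact this.trans (lf_pow (by norm_num))
  refine IsBigO.trans (IsBigO.of_bound C ?_) h3
  filter_upwards [ht.eventually (gt_mem_nhds (show (0:ℝ) < 1 / 2 by norm_num))] with p hp
  have := hφ (a p) (ha p) hp.le
  rw [Real.norm_eq_abs, Real.norm_of_nonneg (pow_nonneg (ha p) 3)]
  refine le_trans (le_of_eq ?_) this
  congr 1; ring

lemma log_bd : ∀ t : ℝ, 0 ≤ t → t ≤ 1 / 2 →
    |Real.log (1 + t) - (0 + 1 * t + (-1 / 2) * t ^ 2)| ≤ 2 * t ^ 3 := by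
  intro t h0 h1
  have h := Real.abs_log_sub_add_sum_range_le (x := -t) (by rw [abs_neg, abs_of_nonneg h0]; linarith) 2
  simp only [Finset.sum_range_succ, Finset.sum_range_zero, abs_neg, abs_of_nonneg h0, sub_neg_eq_add] at h
  refine le_trans (le_of_eq ?_) (h.trans ?_)
  · congr 1; push_cast; ring
  · rw [div_le_iff₀ (by linarith)]
    have : 0 ≤ t ^ 3 := by positivity
    have h3 : t ^ (2 + 1) = t ^ 3 := by norm_num
    rw [h3]
    nlinarith [mul_nonneg this (by linarith : (0:ℝ) ≤ 1 - 2 * t)]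

lemma sqrt_bd : ∀ t : ℝ, 0 ≤ t → t ≤ 1 / 2 →
    |Real.sqrt (1 + t) - (1 + 1 / 2 * t + (-1 / 8) * t ^ 2)| ≤ 1 * t ^ 3 := by
  intro t h0 h1
  set s := Real.sqrt (1 + t) with hs
  have hs2 : s ^ 2 = 1 + t := Real.sq_sqrt (by linarith)
  have hs1 : 1 ≤ s := by rw [hs]; exact Real.one_le_sqrt.2 (by linarith)
  have e : t = s ^ 2 - 1 := by linarith
  have e2 : s - (1 + 1 / 2 * t + (-1 / 8) * t ^ 2) = (s - 1) ^ 3 * ((s + 3) / 8) := by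
    rw [e]; ring
  have hle : s - 1 ≤ t := by nlinarith
  have hle2 : (s + 3) / 8 ≤ 1 := by nlinarith
  rw [e2, abs_of_nonneg (mul_nonneg (pow_nonneg (by linarith) 3) (by linarith))]
  calc (s - 1) ^ 3 * ((s + 3) / 8) ≤ t ^ 3 * 1 :=
        mul_le_mul (pow_le_pow_left₀ (by linarith) hle 3) hle2 (by linarith) (by positivity)
    _ = _ := by ring

lemma X5.integral {a : ℝ × ℝ → ℝ} {c0 c2 c3 c4 : ℝ → ℝ} (H : X5 a c0 c2 c3 c4)
    (hc : ∀ r, 0 < r → Continuous (fun t => a (r, t))) (h3 : ∀ t, c3 (t + Real.pi) = - c3 t) :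
    (fun r : ℝ => (∫ t in (-Real.pi)..Real.pi, a (r, t)) -
      ((∫ t in (-Real.pi)..Real.pi, c0 t) + (∫ t in (-Real.pi)..Real.pi, c2 t) * r ^ 2
        + (∫ t in (-Real.pi)..Real.pi, c4 t) * r ^ 4)) =O[𝓝[>] 0] (fun r => r ^ 5) := by
  obtain ⟨C, hC⟩ := H.h.bound
  rw [lf, eventually_prod_principal_iff] at hC
  refine IsBigO.of_bound (C * (2 * Real.pi)) ?_
  filter_upwards [hC, self_mem_nhdsWithin] with r hr hr0
  have hi := anti_int c3 H.h3 h3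
  have k0 := H.h0; have k2 := H.h2; have k3 := H.h3; have k4 := H.h4
  have ka := hc r hr0
  have hii : ∀ {g : ℝ → ℝ}, Continuous g → IntervalIntegrable g volume (-Real.pi) Real.pi :=
    fun hg => hg.intervalIntegrable _ _
  have e : (∫ t in (-Real.pi)..Real.pi, a (r, t)) -
      ((∫ t in (-Real.pi)..Real.pi, c0 t) + (∫ t in (-Real.pi)..Real.pi, c2 t) * r ^ 2
        + (∫ t in (-Real.pi)..Real.pi, c4 t) * r ^ 4) =
      ∫ t in (-Real.pi)..Real.pi, (a (r, t) - (c0 t + c2 t * r ^ 2 + c3 t * r ^ 3 + c4 t * r ^ 4)) := by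
    rw [intervalIntegral.integral_sub (hii ka) (hii (by fun_prop)),
      intervalIntegral.integral_add (hii (by fun_prop)) (hii (by fun_prop)),
      intervalIntegral.integral_add (hii (by fun_prop)) (hii (by fun_prop)),
      intervalIntegral.integral_add (hii (by fun_prop)) (hii (by fun_prop)),
      intervalIntegral.integral_mul_const, intervalIntegral.integral_mul_const,
      intervalIntegral.integral_mul_const, hi]
    ring
  rw [e]
  have := intervalIntegral.norm_integral_le_of_norm_le_const (a := -Real.pi) (b := Real.pi)
    (C := C * ‖r ^ 5‖)
    (f := fun t => (a (r, t) - (c0 t + c2 t * r ^ 2 + c3 t * r ^ 3 + c4 t * r ^ 4))) (by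
      intro t ht
      rw [Set.uIoc_of_le (by linarith [Real.pi_pos])] at ht
      exact hr t ⟨ht.1.le, ht.2⟩)
  refine this.trans (le_of_eq ?_)
  rw [abs_of_nonneg (by linarith [Real.pi_pos])]
  ring

end Bry

namespace Bry
open Asymptotics Topology

/-- Polar coordinate domain measure (without the Jacobian). -/
noncomputable def pm : Measure (ℝ × ℝ) :=
  (volume.restrict (Set.Ioi (0:ℝ))).prod (volume.restrict (Set.Ioo (-Real.pi) Real.pi))

lemma pm_eq : pm = volume.restrict (Set.Ioi (0:ℝ) ×ˢ Set.Ioo (-Real.pi) Real.pi) := by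
  rw [pm, Measure.prod_restrict]; rfl

lemma pm_pos : ∀ᵐ p ∂pm, 0 < p.1 := by
  rw [pm_eq]
  filter_upwards [ae_restrict_mem (measurableSet_Ioi.prod measurableSet_Ioo)] with p hp
  exact hp.1

/-- dominating function. -/
noncomputable def dom (R σ : ℝ) : ℝ × ℝ → ℝ := fun p => (Set.Ioc 0 R).indicator (fun r => r ^ σ) p.1

lemma dom_integrable (R σ : ℝ) (hσ : -1 < σ) : Integrable (dom R σ) pm := by
  have h1 : Integrable ((Set.Ioc 0 R).indicator (fun r : ℝ => r ^ σ)) (volume.restrict (Set.Ioi 0)) := by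
    refine Integrable.restrict ?_
    rw [integrable_indicator_iff measurableSet_Ioc]
    rcases le_or_gt 0 R with h | h
    · exact (intervalIntegrable_iff_integrableOn_Ioc_of_le h).1
        (intervalIntegral.intervalIntegrable_rpow' hσ)
    · rw [Set.Ioc_eq_empty (by linarith)]; exact integrableOn_empty
  have h2 : Integrable (fun _ : ℝ => (1:ℝ)) (volume.restrict (Set.Ioo (-Real.pi) Real.pi)) :=
    integrable_const _
  have := h1.mul_prod h2
  simp only [mul_one] at this
  exact this

lemma dom_nonneg (R σ : ℝ) (p : ℝ × ℝ) : 0 ≤ dom R σ p := by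
  unfold dom
  refine Set.indicator_nonneg (fun r hr => Real.rpow_nonneg hr.1.le _) _

lemma dom_of {R σ : ℝ} {p : ℝ × ℝ} (h0 : 0 < p.1) (h : p.1 ≤ R) : dom R σ p = p.1 ^ σ := by
  unfold dom
  rw [Set.indicator_of_mem (show p.1 ∈ Set.Ioc 0 R from ⟨h0, h⟩)]

lemma rpow_le_add {r a b c : ℝ} (hr : 0 < r) (hab : a ≤ b) (hbc : b ≤ c) :
    r ^ b ≤ r ^ a + r ^ c := by
  rcases le_or_gt r 1 with h | h
  · have := Real.rpow_le_rpow_of_exponent_ge hr h hab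
    have := Real.rpow_nonneg hr.le c
    linarith
  · have := Real.rpow_le_rpow_of_exponent_le h.le hbc
    have := Real.rpow_nonneg hr.le a
    linarith

lemma pm_meas {E : Type*} [NormedAddCommGroup E] {a : ℝ × ℝ → E} [SecondCountableTopology E]
    (ha : ContinuousOn a (Set.Ioi 0 ×ˢ Set.univ)) : AEStronglyMeasurable a pm := by
  rw [pm_eq]
  refine (ha.mono ?_).aestronglyMeasurable (measurableSet_Ioi.prod measurableSet_Ioo)
  exact Set.prod_mono le_rfl (Set.subset_univ _)

lemma cpow_cont (s : ℂ) : ContinuousOn (fun p : ℝ × ℝ => (p.1 : ℂ) ^ s) (Set.Ioi 0 ×ˢ Set.univ) := by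
  intro p hp
  refine ContinuousAt.continuousWithinAt ?_
  have h : 0 < p.1 := hp.1
  refine ContinuousAt.cpow (by fun_prop) continuousAt_const (Or.inl ?_)
  simpa using h

lemma fam_integrable {a : ℝ × ℝ → ℝ} (ha : ContinuousOn a (Set.Ioi 0 ×ˢ Set.univ)) {R M : ℝ}
    (hR : ∀ p : ℝ × ℝ, R < p.1 → a p = 0) (hM : ∀ p : ℝ × ℝ, 0 < p.1 → |a p| ≤ M) (s : ℂ)
    (hs : -2 < s.re) : Integrable (fun p : ℝ × ℝ => (p.1 : ℂ) ^ (s + 1) * (a p : ℂ)) pm := by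
  have hd := (dom_integrable R (s.re + 1) (by linarith)).const_mul M
  refine hd.mono' (pm_meas ((cpow_cont _).mul (Complex.continuous_ofReal.comp_continuousOn ha))) ?_
  filter_upwards [pm_pos] with p hp
  rcases le_or_gt p.1 R with h | h
  · rw [dom_of hp h, norm_mul, Complex.norm_cpow_eq_rpow_re_of_pos hp, Complex.norm_real,
      Real.norm_eq_abs, mul_comm]
    simp only [add_re, one_re]
    exact mul_le_mul_of_nonneg_right (hM p hp) (Real.rpow_nonneg hp.le _)
  · rw [hR p h]
    simp only [ofReal_zero, mul_zero, norm_zero]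
    have : 0 ≤ M := (abs_nonneg _).trans (hM p hp)
    exact mul_nonneg this (dom_nonneg _ _ _)

lemma family {a : ℝ × ℝ → ℝ} {c0 c2 c3 c4 : ℝ → ℝ}
    (ha : ContinuousOn a (Set.Ioi 0 ×ˢ Set.univ)) {R M : ℝ}
    (hR : ∀ p : ℝ × ℝ, R < p.1 → a p = 0) (hM : ∀ p : ℝ × ℝ, 0 < p.1 → |a p| ≤ M)
    (H : X5 a c0 c2 c3 c4) (h3 : ∀ t, c3 (t + Real.pi) = - c3 t) :
    ∃ G : ℂ → ℂ, (∀ s : ℂ, -2 < s.re → G s = ∫ p, (p.1 : ℂ) ^ (s + 1) * (a p : ℂ) ∂pm) ∧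
      (∀ s : ℂ, -7 < s.re → s ≠ -2 → s ≠ -4 → s ≠ -6 → DifferentiableAt ℂ G s) ∧
      Tendsto (fun s : ℂ => (s + 6) * G s) (𝓝[≠] (-6))
        (𝓝 ((∫ t in (-Real.pi)..Real.pi, c4 t : ℝ) : ℂ)) := by
  set A : ℝ → ℝ := fun r => ∫ t in (-Real.pi)..Real.pi, a (r, t) with hA
  have hc : ∀ r, 0 < r → Continuous (fun t => a (r, t)) := by
    intro r hr
    refine ha.comp_continuous (by fun_prop) ?_
    intro t; exact ⟨hr, trivial⟩
  have hAset : ∀ r, A r = ∫ t in Set.Ioo (-Real.pi) Real.pi, a (r, t) := by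
    intro r
    rw [hA]; simp only
    rw [intervalIntegral.integral_of_le (by linarith [Real.pi_pos]), integral_Ioc_eq_integral_Ioo]
  have hAint : IntegrableOn (fun r => (A r : ℂ)) (Set.Ioi 0) := by
    have h := fam_integrable ha hR hM (-1) (by norm_num)
    have h' := h.integral_prod_left
    refine h'.congr ?_
    filter_upwards with r
    simp only [hAset]
    simp
    exact integral_ofReal
  obtain ⟨G, g1, g2, g3⟩ := mellin_cont (fun r => (A r : ℂ)) hAint.locallyIntegrableOn R
    (by
      intro r hr
      simp only [hA]
      rw [show (fun t => a (r, t)) = fun _ => 0 from funext fun t => hR (r, t) hr]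
      simp)
    ((∫ t in (-Real.pi)..Real.pi, c0 t : ℝ) : ℂ) ((∫ t in (-Real.pi)..Real.pi, c2 t : ℝ) : ℂ)
    ((∫ t in (-Real.pi)..Real.pi, c4 t : ℝ) : ℂ)
    (by
      have := H.integral hc h3
      refine IsBigO.of_norm_left (this.norm_left.congr_left ?_)
      intro r
      rw [← Complex.norm_real]
      push_cast
      rfl)
  refine ⟨G, ?_, g2, g3⟩
  intro s hs
  rw [g1 s hs, mellin, pm, integral_prod _ (fam_integrable ha hR hM s hs)]
  refine integral_congr_ae (Eventually.of_forall fun r => ?_)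
  simp only [hAset, smul_eq_mul]
  rw [integral_const_mul, show s + 2 - 1 = s + 1 by ring]
  congr 1
  exact integral_ofReal.symm

/-- Remainder of the exponential series. -/
noncomputable def Er (s : ℂ) (l : ℝ) : ℂ := exp (s * l / 2) - (1 + s * l / 2 + s ^ 2 * l ^ 2 / 8)

lemma Er_bound (s : ℂ) (l S T : ℝ) (hl : 0 ≤ l) (hT : l ≤ T) (hs : ‖s‖ ≤ S) :
    ‖Er s l‖ ≤ (S * l) ^ 3 * Real.exp (S * T) := by
  have h := Complex.norm_exp_sub_sum_le_norm_mul_exp (s * l / 2) 3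
  have e : Er s l = exp (s * l / 2) - ∑ m ∈ Finset.range 3, (s * l / 2) ^ m / (m.factorial : ℂ) := by
    simp only [Er, Finset.sum_range_succ, Finset.sum_range_zero, Nat.factorial]
    push_cast
    ring
  have hS : 0 ≤ S := (norm_nonneg _).trans hs
  have hn : ‖s * l / 2‖ ≤ S * l := by
    rw [norm_div, norm_mul, Complex.norm_real, Real.norm_of_nonneg hl]
    have : ‖s‖ * l ≤ S * l := mul_le_mul_of_nonneg_right hs hl
    have h2 : 0 ≤ ‖s‖ * l := by positivity
    simp only [Complex.norm_ofNat]
    linarith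
  rw [e]
  refine h.trans ?_
  have : S * l ≤ S * T := mul_le_mul_of_nonneg_left hT hS
  have h1 : Real.exp ‖s * l / 2‖ ≤ Real.exp (S * T) := Real.exp_le_exp.2 (hn.trans this)
  exact mul_le_mul (pow_le_pow_left₀ (norm_nonneg _) hn 3) h1 (Real.exp_pos _).le (by positivity)

section err
variable {a L : ℝ × ℝ → ℝ} {R M K : ℝ}

lemma err_cont (ha : ContinuousOn a (Set.Ioi 0 ×ˢ Set.univ)) (hL : ContinuousOn L (Set.Ioi 0 ×ˢ Set.univ))
    (s : ℂ) :
    AEStronglyMeasurable (fun p : ℝ × ℝ => (p.1 : ℂ) ^ (s + 1) * (a p : ℂ) * Er s (L p)) pm := by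
  refine pm_meas (((cpow_cont _).mul (Complex.continuous_ofReal.comp_continuousOn ha)).mul ?_)
  have : Continuous (Er s) := by unfold Er; fun_prop
  exact this.comp_continuousOn hL

lemma err_bound (hR : ∀ p : ℝ × ℝ, R < p.1 → a p = 0) (hM : ∀ p : ℝ × ℝ, 0 < p.1 → |a p| ≤ M)
    (hK : 0 ≤ K) (hL0 : ∀ p, 0 ≤ L p) (hLK : ∀ p : ℝ × ℝ, 0 < p.1 → p.1 ≤ R → L p ≤ K * p.1 ^ 2)
    (s₀ : ℂ) (p : ℝ × ℝ) (hp : 0 < p.1) (s : ℂ) (hs : s ∈ Metric.ball s₀ (1 / 2)) :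
    ‖(p.1 : ℂ) ^ (s + 1) * (a p : ℂ) * Er s (L p)‖ ≤
      (M * (((‖s₀‖ + 1) * K) ^ 3 * Real.exp ((‖s₀‖ + 1) * (K * R ^ 2)))) *
        (dom R (s₀.re + 13 / 2) p + dom R (s₀.re + 15 / 2) p) := by
  have hM0 : 0 ≤ M := (abs_nonneg _).trans (hM p hp)
  rcases le_or_gt p.1 R with h | h
  · have hd : ‖s - s₀‖ < 1 / 2 := by simpa [dist_eq_norm] using hs
    have hsn : ‖s‖ ≤ ‖s₀‖ + 1 := by
      have := norm_add_le s₀ (s - s₀)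
      rw [add_sub_cancel] at this
      linarith
    have hre : |s.re - s₀.re| < 1 / 2 := by
      have := Complex.abs_re_le_norm (s - s₀)
      rw [sub_re] at this
      linarith
    rw [abs_lt] at hre
    have hlk := hLK p hp h
    have hE := Er_bound s (L p) (‖s₀‖ + 1) (K * R ^ 2) (hL0 p)
      (hlk.trans (mul_le_mul_of_nonneg_left (pow_le_pow_left₀ hp.le h 2) hK)) hsn
    have hE2 : ‖Er s (L p)‖ ≤ (((‖s₀‖ + 1) * K) ^ 3 * Real.exp ((‖s₀‖ + 1) * (K * R ^ 2))) * p.1 ^ 6 := by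
      refine hE.trans ?_
      have : (‖s₀‖ + 1) * L p ≤ (‖s₀‖ + 1) * (K * p.1 ^ 2) :=
        mul_le_mul_of_nonneg_left hlk (by positivity)
      have h3 := pow_le_pow_left₀ (mul_nonneg (by positivity) (hL0 p)) this 3
      calc _ ≤ ((‖s₀‖ + 1) * (K * p.1 ^ 2)) ^ 3 * Real.exp ((‖s₀‖ + 1) * (K * R ^ 2)) :=
            mul_le_mul_of_nonneg_right h3 (Real.exp_pos _).le
        _ = _ := by ring
    rw [dom_of hp h, dom_of hp h, norm_mul, norm_mul, Complex.norm_cpow_eq_rpow_re_of_pos hp,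
      Complex.norm_real, Real.norm_eq_abs]
    simp only [add_re, one_re]
    have hr := rpow_le_add (r := p.1) (a := s₀.re + 13 / 2) (b := s.re + 7) (c := s₀.re + 15 / 2) hp
      (by linarith) (by linarith)
    have hr2 : p.1 ^ (s.re + 7) = p.1 ^ (s.re + 1) * p.1 ^ 6 := by
      rw [← Real.rpow_natCast, ← Real.rpow_add hp]
      congr 1; push_cast; ring
    have hq : 0 ≤ p.1 ^ (s.re + 1) := Real.rpow_nonneg hp.le _
    calc p.1 ^ (s.re + 1) * |a p| * ‖Er s (L p)‖ ≤ p.1 ^ (s.re + 1) * M *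
          ((((‖s₀‖ + 1) * K) ^ 3 * Real.exp ((‖s₀‖ + 1) * (K * R ^ 2))) * p.1 ^ 6) :=
          mul_le_mul (mul_le_mul_of_nonneg_left (hM p hp) hq) hE2 (norm_nonneg _) (by positivity)
      _ = (M * (((‖s₀‖ + 1) * K) ^ 3 * Real.exp ((‖s₀‖ + 1) * (K * R ^ 2)))) * p.1 ^ (s.re + 7) := by
          rw [hr2]; ring
      _ ≤ _ := mul_le_mul_of_nonneg_left hr (by positivity)
  · rw [hR p h]
    simp only [ofReal_zero, mul_zero, zero_mul, norm_zero]
    exact mul_nonneg (by positivity) (add_nonneg (dom_nonneg _ _ _) (dom_nonneg _ _ _))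

lemma err_dom (s₀ : ℂ) (h : -7 < s₀.re) (c : ℝ) : Integrable (fun p => c *
        (dom R (s₀.re + 13 / 2) p + dom R (s₀.re + 15 / 2) p)) pm :=
  ((dom_integrable R _ (by linarith)).add (dom_integrable R _ (by linarith))).const_mul c

lemma err_integrable (ha : ContinuousOn a (Set.Ioi 0 ×ˢ Set.univ))
    (hL : ContinuousOn L (Set.Ioi 0 ×ˢ Set.univ))
    (hR : ∀ p : ℝ × ℝ, R < p.1 → a p = 0) (hM : ∀ p : ℝ × ℝ, 0 < p.1 → |a p| ≤ M)
    (hK : 0 ≤ K) (hL0 : ∀ p, 0 ≤ L p) (hLK : ∀ p : ℝ × ℝ, 0 < p.1 → p.1 ≤ R → L p ≤ K * p.1 ^ 2)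
    (s : ℂ) (hs : -7 < s.re) :
    Integrable (fun p : ℝ × ℝ => (p.1 : ℂ) ^ (s + 1) * (a p : ℂ) * Er s (L p)) pm := by
  refine (err_dom (R := R) s hs
    (M * (((‖s‖ + 1) * K) ^ 3 * Real.exp ((‖s‖ + 1) * (K * R ^ 2))))).mono' (err_cont ha hL s) ?_
  · filter_upwards [pm_pos] with p hp
    exact err_bound hR hM hK hL0 hLK s p hp s (Metric.mem_ball_self (by norm_num))

lemma err_diff (ha : ContinuousOn a (Set.Ioi 0 ×ˢ Set.univ))
    (hL : ContinuousOn L (Set.Ioi 0 ×ˢ Set.univ))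
    (hR : ∀ p : ℝ × ℝ, R < p.1 → a p = 0) (hM : ∀ p : ℝ × ℝ, 0 < p.1 → |a p| ≤ M)
    (hK : 0 ≤ K) (hL0 : ∀ p, 0 ≤ L p) (hLK : ∀ p : ℝ × ℝ, 0 < p.1 → p.1 ≤ R → L p ≤ K * p.1 ^ 2)
    (s : ℂ) (hs : -7 < s.re) :
    DifferentiableAt ℂ (fun s => ∫ p, (p.1 : ℂ) ^ (s + 1) * (a p : ℂ) * Er s (L p) ∂pm) s := by
  refine hol_int pm (fun s p => (p.1 : ℂ) ^ (s + 1) * (a p : ℂ) * Er s (L p)) s (1 / 2) (by norm_num)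
    _ (err_dom (R := R) s hs
    (M * (((‖s‖ + 1) * K) ^ 3 * Real.exp ((‖s‖ + 1) * (K * R ^ 2))))) (fun s => err_cont ha hL s) ?_ ?_
  rotate_left
  · filter_upwards [pm_pos] with p hp s' hs'
    exact err_bound hR hM hK hL0 hLK s p hp s' hs'
  · filter_upwards [pm_pos] with p hp
    have hne : (p.1 : ℂ) ≠ 0 := by exact_mod_cast hp.ne'
    unfold Er
    have : Differentiable ℂ (fun s : ℂ => (p.1 : ℂ) ^ (s + 1)) :=
      Differentiable.const_cpow (by fun_prop) (Or.inl hne)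
    fun_prop

end err

lemma assemble {a L : ℝ × ℝ → ℝ} {R M K : ℝ} {c0 c2 c3 c4 d0 d2 d3 d4 e0 e2 e3 e4 : ℝ → ℝ}
    (ha : ContinuousOn a (Set.Ioi 0 ×ˢ Set.univ))
    (hL : ContinuousOn L (Set.Ioi 0 ×ˢ Set.univ))
    (hR : ∀ p : ℝ × ℝ, R < p.1 → a p = 0) (hM : ∀ p : ℝ × ℝ, 0 < p.1 → |a p| ≤ M)
    (hK : 0 ≤ K) (hL0 : ∀ p, 0 ≤ L p) (hLK : ∀ p : ℝ × ℝ, 0 < p.1 → p.1 ≤ R → L p ≤ K * p.1 ^ 2)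
    (H0 : X5 a c0 c2 c3 c4) (H1 : X5 (fun p => a p * L p) d0 d2 d3 d4)
    (H2 : X5 (fun p => a p * L p ^ 2) e0 e2 e3 e4)
    (h0 : ∀ t, c3 (t + Real.pi) = - c3 t) (h1 : ∀ t, d3 (t + Real.pi) = - d3 t)
    (h2 : ∀ t, e3 (t + Real.pi) = - e3 t) :
    ∃ F : ℂ → ℂ, (∀ s : ℂ, -2 < s.re → F s =
        ∫ p, (p.1 : ℂ) ^ (s + 1) * (a p : ℂ) * exp (s * L p / 2) ∂pm) ∧
      (∀ s : ℂ, -7 < s.re → s ≠ -2 → s ≠ -4 → s ≠ -6 → DifferentiableAt ℂ F s) ∧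
      Tendsto (fun s : ℂ => (s + 6) * F s) (𝓝[≠] (-6))
        (𝓝 ((∫ t in (-Real.pi)..Real.pi, (c4 t - 3 * d4 t + 9 / 2 * e4 t) : ℝ) : ℂ)) := by
  have hM0 : 0 ≤ M := (abs_nonneg _).trans (hM (1, 0) one_pos)
  have hLb : ∀ p : ℝ × ℝ, 0 < p.1 → p.1 ≤ R → L p ≤ K * R ^ 2 := fun p hp h =>
    (hLK p hp h).trans (mul_le_mul_of_nonneg_left (pow_le_pow_left₀ hp.le h 2) hK)
  have ha1 : ContinuousOn (fun p => a p * L p) (Set.Ioi 0 ×ˢ Set.univ) := ha.mul hL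
  have ha2 : ContinuousOn (fun p => a p * L p ^ 2) (Set.Ioi 0 ×ˢ Set.univ) := ha.mul (hL.pow 2)
  have hR1 : ∀ p : ℝ × ℝ, R < p.1 → a p * L p = 0 := fun p hp => by rw [hR p hp, zero_mul]
  have hR2 : ∀ p : ℝ × ℝ, R < p.1 → a p * L p ^ 2 = 0 := fun p hp => by rw [hR p hp, zero_mul]
  have hM1 : ∀ p : ℝ × ℝ, 0 < p.1 → |a p * L p| ≤ M * (K * R ^ 2) := by
    intro p hp
    rcases le_or_gt p.1 R with h | h
    · rw [abs_mul, abs_of_nonneg (hL0 p)]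
      exact mul_le_mul (hM p hp) (hLb p hp h) (hL0 p) hM0
    · rw [hR1 p h, abs_zero]; positivity
  have hM2 : ∀ p : ℝ × ℝ, 0 < p.1 → |a p * L p ^ 2| ≤ M * (K * R ^ 2) ^ 2 := by
    intro p hp
    rcases le_or_gt p.1 R with h | h
    · rw [abs_mul, abs_of_nonneg (pow_nonneg (hL0 p) 2)]
      exact mul_le_mul (hM p hp) (pow_le_pow_left₀ (hL0 p) (hLb p hp h) 2) (pow_nonneg (hL0 p) 2) hM0
    · rw [hR2 p h, abs_zero]; positivity
  obtain ⟨G0, f0, g0, t0⟩ := family ha hR hM H0 h0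
  obtain ⟨G1, f1, g1, t1⟩ := family ha1 hR1 hM1 H1 h1
  obtain ⟨G2, f2, g2, t2⟩ := family ha2 hR2 hM2 H2 h2
  have gE := err_diff ha hL hR hM hK hL0 hLK
  set GE : ℂ → ℂ := fun s => ∫ p, (p.1 : ℂ) ^ (s + 1) * (a p : ℂ) * Er s (L p) ∂pm with hGE
  refine ⟨fun s => G0 s + s / 2 * G1 s + s ^ 2 / 8 * G2 s + GE s, ?_, ?_, ?_⟩
  · intro s hs
    have i0 := fam_integrable ha hR hM s hs
    have i1 := (fam_integrable ha1 hR1 hM1 s hs).const_mul (s / 2)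
    have i2 := (fam_integrable ha2 hR2 hM2 s hs).const_mul (s ^ 2 / 8)
    have i3 := err_integrable ha hL hR hM hK hL0 hLK s (by linarith)
    simp only [f0 s hs, f1 s hs, f2 s hs, hGE]
    have i01 : Integrable (fun p : ℝ × ℝ => (p.1 : ℂ) ^ (s + 1) * (a p : ℂ) +
      s / 2 * ((p.1 : ℂ) ^ (s + 1) * ((a p * L p : ℝ) : ℂ))) pm := i0.add i1
    have i012 : Integrable (fun p : ℝ × ℝ => (p.1 : ℂ) ^ (s + 1) * (a p : ℂ) +
      s / 2 * ((p.1 : ℂ) ^ (s + 1) * ((a p * L p : ℝ) : ℂ)) +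
      s ^ 2 / 8 * ((p.1 : ℂ) ^ (s + 1) * ((a p * L p ^ 2 : ℝ) : ℂ))) pm := i01.add i2
    rw [← integral_const_mul, ← integral_const_mul, ← integral_add i0 i1,
      ← integral_add i01 i2, ← integral_add i012 i3]
    refine integral_congr_ae (Eventually.of_forall fun p => ?_)
    simp only [Er]
    push_cast
    ring
  · intro s hs n2 n4 n6
    have k0 := g0 s hs n2 n4 n6
    have k1 := g1 s hs n2 n4 n6
    have k2 := g2 s hs n2 n4 n6
    have k3 := gE s hs
    fun_prop
  · have hE : Tendsto (fun s : ℂ => (s + 6) * GE s) (𝓝[≠] (-6)) (𝓝 0) := by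
      have c := (gE (-6) (by norm_num)).continuousAt
      have c2 : ContinuousAt (fun s : ℂ => (s + 6) * GE s) (-6) := by fun_prop
      have := c2.tendsto
      simp only [neg_add_cancel, zero_mul] at this
      exact this.mono_left nhdsWithin_le_nhds
    have hid : Tendsto (fun s : ℂ => s / 2) (𝓝[≠] (-6)) (𝓝 (-6 / 2)) :=
      (by fun_prop : ContinuousAt (fun s : ℂ => s / 2) (-6)).tendsto.mono_left nhdsWithin_le_nhds
    have hid2 : Tendsto (fun s : ℂ => s ^ 2 / 8) (𝓝[≠] (-6)) (𝓝 ((-6) ^ 2 / 8)) :=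
      (by fun_prop : ContinuousAt (fun s : ℂ => s ^ 2 / 8) (-6)).tendsto.mono_left nhdsWithin_le_nhds
    have := ((t0.add (hid.mul t1)).add (hid2.mul t2)).add hE
    have k0 := H0.h4
    have k1 := H1.h4
    have k2 := H2.h4
    have hii : ∀ {g : ℝ → ℝ}, Continuous g → IntervalIntegrable g volume (-Real.pi) Real.pi :=
      fun hg => hg.intervalIntegrable _ _
    rw [intervalIntegral.integral_add (hii (by fun_prop)) (hii (by fun_prop)),
      intervalIntegral.integral_sub (hii (by fun_prop)) (hii (by fun_prop)),
      intervalIntegral.integral_const_mul, intervalIntegral.integral_const_mul]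
    refine (this.congr ?_).trans (le_of_eq ?_)
    · intro s; ring
    · congr 1; push_cast; ring

end Bry

namespace Bry
open Asymptotics Topology

/-- Standard basis vectors. -/
noncomputable def vx : E2 := EuclideanSpace.single 0 1
/-- Standard basis vectors. -/
noncomputable def vy : E2 := EuclideanSpace.single 1 1

lemma norm_xy (x y : ℝ) : ‖x • vx + y • vy‖ ^ 2 = x ^ 2 + y ^ 2 := by
  rw [EuclideanSpace.norm_sq_eq]
  simp [Fin.sum_univ_two, vx, vy]

/-- Polar parametrization. -/
noncomputable def Pp (p : ℝ × ℝ) : E2 := (p.1 * Real.cos p.2) • vx + (p.1 * Real.sin p.2) • vy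

lemma Pp_cont : Continuous Pp := by unfold Pp; fun_prop

lemma norm_Pp (p : ℝ × ℝ) : ‖Pp p‖ = |p.1| := by
  rw [← abs_norm, ← sq_eq_sq_iff_abs_eq_abs, Pp, norm_xy]
  have := Real.sin_sq_add_cos_sq p.2
  linear_combination p.1 ^ 2 * this

lemma integral_polar (Φ : E2 → ℂ) : ∫ w, Φ w = ∫ p, (p.1 : ℂ) * Φ (Pp p) ∂pm := by
  rw [← (PiLp.volume_preserving_toLp (Fin 2)).integral_comp
    (MeasurableEquiv.toLp 2 _).measurableEmbedding]
  rw [← (volume_preserving_finTwoArrow ℝ).symm.integral_comp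
    (MeasurableEquiv.finTwoArrow).symm.measurableEmbedding]
  rw [← integral_comp_polarCoord_symm, pm_eq]
  refine integral_congr_ae (Eventually.of_forall fun p => ?_)
  simp only [polarCoord_symm_apply]
  rw [Complex.real_smul]
  congr 2
  ext i
  fin_cases i <;> simp [Pp, vx, vy, MeasurableEquiv.finTwoArrow]

lemma grad_sq {f : E2 → ℝ} (w : E2) : ‖gradient f w‖ ^ 2 = D vx f w ^ 2 + D vy f w ^ 2 := by
  have h : ∀ v, D v f w = inner ℝ (gradient f w) v := by
    intro v
    simp [D, gradient]
  rw [h, h, EuclideanSpace.norm_sq_eq]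
  generalize gradient f w = g
  simp [Fin.sum_univ_two, vx, vy, EuclideanSpace.inner_single_right]

lemma fderiv_zero_of_grad {f : E2 → ℝ} (h : gradient f 0 = 0) : fderiv ℝ f 0 = 0 := by
  simpa [gradient] using h

lemma f_quad {f : E2 → ℝ} (hf : ContDiff ℝ (⊤ : ℕ∞) f) (hf0 : f 0 = 0) (h : fderiv ℝ f 0 = 0)
    (R : ℝ) : ∃ K, 0 ≤ K ∧ ∀ w, ‖w‖ ≤ R → |f w| ≤ K * ‖w‖ ^ 2 := by
  obtain ⟨C, h0, hC⟩ := taylor_bound hf 1 R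
  refine ⟨C, h0, fun w hw => ?_⟩
  have := hC w hw
  simpa [Finset.sum_range_succ, hf0, iteratedFDeriv_one_apply, h] using this

lemma cpow_polar {r y : ℝ} (hr : 0 < r) (s : ℂ) :
    (r : ℂ) * ((r ^ 2 + y ^ 2 : ℝ) : ℂ) ^ (s / 2) =
      (r : ℂ) ^ (s + 1) * exp (s * (Real.log (1 + (y / r) ^ 2) : ℝ) / 2) := by
  have hp : 0 < 1 + (y / r) ^ 2 := by positivity
  have e : r ^ 2 + y ^ 2 = r ^ 2 * (1 + (y / r) ^ 2) := by field_simp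
  have hne : (r : ℂ) ≠ 0 := by exact_mod_cast hr.ne'
  have hp' : 0 < r ^ 2 * (1 + (y / r) ^ 2) := by positivity
  rw [e, Complex.cpow_def_of_ne_zero (by exact_mod_cast hp'.ne'),
    Complex.cpow_def_of_ne_zero hne, ← Complex.ofReal_log hp'.le, ← Complex.ofReal_log hr.le,
    Real.log_mul (by positivity) hp.ne', Real.log_pow]
  nth_rewrite 1 [← Complex.exp_log hne]
  rw [← Complex.ofReal_log hr.le, ← Complex.exp_add, ← Complex.exp_add]
  congr 1
  push_cast
  ring

lemma lf_norm_bound {u : ℝ × ℝ → ℝ} {C : ℝ} {n : ℕ}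
    (h : ∀ p : ℝ × ℝ, 0 < p.1 → p.1 ≤ 1 → |u p| ≤ C * p.1 ^ n) :
    u =O[lf] (fun p => p.1 ^ n) := by
  refine IsBigO.of_bound C ?_
  filter_upwards [lf_pos, lf_lt one_pos] with p hp hp1
  rw [Real.norm_eq_abs, norm_pow, Real.norm_of_nonneg hp.le]
  exact h p hp hp1.le

theorem main (f : E2 → ℝ) (hf : ContDiff ℝ (⊤ : ℕ∞) f) (hf0 : f 0 = 0) (hgrad : gradient f 0 = 0)
    (ψ : E2 → ℝ) (hψ : ContDiff ℝ (⊤ : ℕ∞) ψ) (hψc : HasCompactSupport ψ)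
    (hψ1 : ∀ᶠ w in nhds (0 : E2), ψ w = 1)
    (b₁ b₂ b₃ c₁ c₂ c₃ c₄ d₁ d₂ d₃ d₄ d₅ : ℝ)
    (hb₁ : b₁ = (1 / 2) * iteratedFDeriv ℝ 2 f 0 ![vx, vx])
    (hb₂ : b₂ = iteratedFDeriv ℝ 2 f 0 ![vx, vy])
    (hb₃ : b₃ = (1 / 2) * iteratedFDeriv ℝ 2 f 0 ![vy, vy])
    (hc₁ : c₁ = (1 / 6) * iteratedFDeriv ℝ 3 f 0 ![vx, vx, vx])
    (hc₂ : c₂ = (1 / 2) * iteratedFDeriv ℝ 3 f 0 ![vx, vx, vy])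
    (hc₃ : c₃ = (1 / 2) * iteratedFDeriv ℝ 3 f 0 ![vx, vy, vy])
    (hc₄ : c₄ = (1 / 6) * iteratedFDeriv ℝ 3 f 0 ![vy, vy, vy])
    (hd₁ : d₁ = (1 / 24) * iteratedFDeriv ℝ 4 f 0 ![vx, vx, vx, vx])
    (hd₂ : d₂ = (1 / 6) * iteratedFDeriv ℝ 4 f 0 ![vx, vx, vx, vy])
    (hd₃ : d₃ = (1 / 4) * iteratedFDeriv ℝ 4 f 0 ![vx, vx, vy, vy])
    (hd₄ : d₄ = (1 / 6) * iteratedFDeriv ℝ 4 f 0 ![vx, vy, vy, vy])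
    (hd₅ : d₅ = (1 / 24) * iteratedFDeriv ℝ 4 f 0 ![vy, vy, vy, vy]) :
    ∃ F : ℂ → ℂ,
      (∀ s : ℂ, -2 < s.re →
        F s = ∫ w : E2,
          (((‖w‖ ^ 2 + (f w) ^ 2 : ℝ) : ℂ) ^ (s / 2)) * (ψ w : ℂ)
            * ((Real.sqrt (1 + ‖gradient f w‖ ^ 2) : ℝ) : ℂ)) ∧
      (∀ s : ℂ, -7 < s.re → s ≠ -2 → s ≠ -4 → s ≠ -6 → DifferentiableAt ℂ F s) ∧
      Tendsto (fun s : ℂ => (s + 6) * F s) (𝓝[≠] (-6))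
        (𝓝 ((∫ t in (-Real.pi)..Real.pi,
          tot b₁ b₂ b₃ c₁ c₂ c₃ c₄ d₁ d₂ d₃ d₄ d₅ (Real.cos t) (Real.sin t) : ℝ) : ℂ)) := by
  have hfd := fderiv_zero_of_grad hgrad
  have hx0 : D vx f 0 = 0 := by simp [D, hfd]
  have hy0 : D vy f 0 = 0 := by simp [D, hfd]
  have cf : Continuous f := hf.continuous
  have cX : Continuous (D vx f) := (D_smooth hf vx).continuous
  have cY : Continuous (D vy f) := (D_smooth hf vy).continuous
  have cψ : Continuous ψ := hψ.continuous
  have cP := Pp_cont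
  obtain ⟨C, hC0, hC⟩ := taylor_f hf hf0 vx vy hx0 hy0 b₁ b₂ b₃ c₁ c₂ c₃ c₄ d₁ d₂ d₃ d₄ d₅
    hb₁ hb₂ hb₃ hc₁ hc₂ hc₃ hc₄ hd₁ hd₂ hd₃ hd₄ hd₅ 1
  set B : ℝ → ℝ := fun t => fB b₁ b₂ b₃ (Real.cos t) (Real.sin t) with hB
  set Cc : ℝ → ℝ := fun t => fC c₁ c₂ c₃ c₄ (Real.cos t) (Real.sin t) with hCc
  set Dd : ℝ → ℝ := fun t => fD d₁ d₂ d₃ d₄ d₅ (Real.cos t) (Real.sin t) with hDd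
  set Bx : ℝ → ℝ := fun t => fBx b₁ b₂ (Real.cos t) (Real.sin t) with hBx
  set By : ℝ → ℝ := fun t => fBy b₂ b₃ (Real.cos t) (Real.sin t) with hBy
  set Cx : ℝ → ℝ := fun t => fCx c₁ c₂ c₃ (Real.cos t) (Real.sin t) with hCx
  set Cy : ℝ → ℝ := fun t => fCy c₂ c₃ c₄ (Real.cos t) (Real.sin t) with hCy
  set Dx : ℝ → ℝ := fun t => fDx d₁ d₂ d₃ d₄ (Real.cos t) (Real.sin t) with hDx
  set Dy : ℝ → ℝ := fun t => fDy d₂ d₃ d₄ d₅ (Real.cos t) (Real.sin t) with hDy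
  have kB : Continuous B := by simp only [hB, fB]; fun_prop
  have kC : Continuous Cc := by simp only [hCc, fC]; fun_prop
  have kD : Continuous Dd := by simp only [hDd, fD]; fun_prop
  have kBx : Continuous Bx := by simp only [hBx, fBx]; fun_prop
  have kBy : Continuous By := by simp only [hBy, fBy]; fun_prop
  have kCx : Continuous Cx := by simp only [hCx, fCx]; fun_prop
  have kCy : Continuous Cy := by simp only [hCy, fCy]; fun_prop
  have kDx : Continuous Dx := by simp only [hDx, fDx]; fun_prop
  have kDy : Continuous Dy := by simp only [hDy, fDy]; fun_prop
  have aB : ∀ t, B (t + Real.pi) = B t := by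
    intro t; simp only [hB, fB, Real.cos_add_pi, Real.sin_add_pi]; ring
  have aC : ∀ t, Cc (t + Real.pi) = - Cc t := by
    intro t; simp only [hCc, fC, Real.cos_add_pi, Real.sin_add_pi]; ring
  have aBx : ∀ t, Bx (t + Real.pi) = - Bx t := by
    intro t; simp only [hBx, fBx, Real.cos_add_pi, Real.sin_add_pi]; ring
  have aBy : ∀ t, By (t + Real.pi) = - By t := by
    intro t; simp only [hBy, fBy, Real.cos_add_pi, Real.sin_add_pi]; ring
  have aCx : ∀ t, Cx (t + Real.pi) = Cx t := by
    intro t; simp only [hCx, fCx, Real.cos_add_pi, Real.sin_add_pi]; ring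
  have aCy : ∀ t, Cy (t + Real.pi) = Cy t := by
    intro t; simp only [hCy, fCy, Real.cos_add_pi, Real.sin_add_pi]; ring
  -- the basic expansions
  have hCP : ∀ p : ℝ × ℝ, 0 < p.1 → p.1 ≤ 1 →
      |f (Pp p) - p.1 ^ 2 * (B p.2 + Cc p.2 * p.1 + Dd p.2 * p.1 ^ 2)| ≤ C * p.1 ^ 5 ∧
      |D vx f (Pp p) - p.1 * (Bx p.2 + Cx p.2 * p.1 + Dx p.2 * p.1 ^ 2)| ≤ C * p.1 ^ 4 ∧
      |D vy f (Pp p) - p.1 * (By p.2 + Cy p.2 * p.1 + Dy p.2 * p.1 ^ 2)| ≤ C * p.1 ^ 4 := by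
    intro p hp hp1
    have hn : ‖Pp p‖ = p.1 := by rw [norm_Pp, abs_of_pos hp]
    have := hC (p.1 * Real.cos p.2) (p.1 * Real.sin p.2) (by rw [← Pp, hn]; exact hp1)
    rw [← Pp, hn] at this
    obtain ⟨t1, t2, t3⟩ := this
    refine ⟨le_trans (le_of_eq ?_) t1, le_trans (le_of_eq ?_) t2, le_trans (le_of_eq ?_) t3⟩
    · congr 2; simp only [hB, hCc, hDd, fB, fC, fD]; ring
    · congr 2; simp only [hBx, hCx, hDx, fBx, fCx, fDx]; ring
    · congr 2; simp only [hBy, hCy, hDy, fBy, fCy, fDy]; ring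
  have Xg := X5.sq_exp (u := fun p => f (Pp p) / p.1) kB kC kD (by
    refine lf_norm_bound (C := C) fun p hp hp1 => ?_
    have h := (hCP p hp hp1).1
    have e : f (Pp p) / p.1 - p.1 * (B p.2 + Cc p.2 * p.1 + Dd p.2 * p.1 ^ 2) =
      (f (Pp p) - p.1 ^ 2 * (B p.2 + Cc p.2 * p.1 + Dd p.2 * p.1 ^ 2)) / p.1 := by
      field_simp
    rw [e, abs_div, abs_of_pos hp, div_le_iff₀ hp]
    refine h.trans (le_of_eq (by ring)))
  have Xx := X5.sq_exp (u := fun p => D vx f (Pp p)) kBx kCx kDx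
    (lf_norm_bound (C := C) fun p hp hp1 => (hCP p hp hp1).2.1)
  have Xy := X5.sq_exp (u := fun p => D vy f (Pp p)) kBy kCy kDy
    (lf_norm_bound (C := C) fun p hp hp1 => (hCP p hp hp1).2.2)
  have Xp : X5 (fun p => D vx f (Pp p) ^ 2 + D vy f (Pp p) ^ 2) (fun _ => 0)
      (fun t => Bx t ^ 2 + By t ^ 2) (fun t => 2 * (Bx t * Cx t + By t * Cy t))
      (fun t => Cx t ^ 2 + Cy t ^ 2 + 2 * (Bx t * Dx t + By t * Dy t)) := by
    refine (Xx.lin Xy 1 1).of_eq ?_ ?_ ?_ ?_ ?_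
    · refine (isBigO_zero _ _).congr_left ?_
      intro p; ring
    all_goals intro t; ring
  have XJ := Xp.comp_aux (fun p => by positivity) (fun t => Real.sqrt (1 + t)) 1 (1 / 2) (-1 / 8) 1
    sqrt_bd
  have XL := Xg.comp_aux (fun p => by positivity) (fun t => Real.log (1 + t)) 0 1 (-1 / 2) 2
    log_bd
  set L : ℝ × ℝ → ℝ := fun p => Real.log (1 + (f (Pp p) / p.1) ^ 2) with hL
  set a : ℝ × ℝ → ℝ := fun p => ψ (Pp p) *
    Real.sqrt (1 + (D vx f (Pp p) ^ 2 + D vy f (Pp p) ^ 2)) with ha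
  have Xa : X5 a (fun _ => 1) (fun t => 1 / 2 * (Bx t ^ 2 + By t ^ 2))
      (fun t => 1 / 2 * (2 * (Bx t * Cx t + By t * Cy t)))
      (fun t => 1 / 2 * (Cx t ^ 2 + Cy t ^ 2 + 2 * (Bx t * Dx t + By t * Dy t))
        + (-1 / 8) * (Bx t ^ 2 + By t ^ 2) ^ 2) := by
    refine XJ.of_eq ?_ (fun _ => rfl) (fun _ => rfl) (fun _ => rfl) (fun _ => rfl)
    refine (isBigO_zero _ _).congr' ?_ (EventuallyEq.refl _ _)
    obtain ⟨ε, hε, hb⟩ := Metric.eventually_nhds_iff.1 hψ1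
    filter_upwards [lf_pos, lf_lt hε] with p hp hpε
    have : ψ (Pp p) = 1 := hb (by rw [dist_zero_right, norm_Pp, abs_of_pos hp]; exact hpε)
    simp only [ha, this, one_mul, sub_self]
  have XaL := Xa.mul XL
  have XaL2 := Xa.mul (XL.mul XL)
  have XaL2' := XaL2.of_eq (a' := fun p => a p * L p ^ 2) ((isBigO_zero _ _).congr_left
    (fun p => by ring)) (fun _ => rfl) (fun _ => rfl) (fun _ => rfl) (fun _ => rfl)
  -- bounds
  set ρ : E2 → ℝ := fun w => ψ w * Real.sqrt (1 + (D vx f w ^ 2 + D vy f w ^ 2)) with hρ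
  have cρ : Continuous ρ := by simp only [hρ]; fun_prop
  have sρ : HasCompactSupport ρ := hψc.mul_right
  obtain ⟨M, hM⟩ := cρ.bounded_above_of_compact_support sρ
  obtain ⟨R, hR⟩ := hψc.isCompact.isBounded.exists_norm_le
  obtain ⟨K, hK0, hK⟩ := f_quad hf hf0 hfd R
  have ca : ContinuousOn a (Set.Ioi 0 ×ˢ Set.univ) := (cρ.comp cP).continuousOn
  have cL : ContinuousOn L (Set.Ioi 0 ×ˢ Set.univ) := by
    refine ContinuousOn.log ?_ (fun p _ => by positivity)
    refine continuousOn_const.add (ContinuousOn.pow ?_ 2)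
    exact (cf.comp cP).continuousOn.div continuous_fst.continuousOn (fun p hp => (ne_of_gt hp.1))
  have L0 : ∀ p, 0 ≤ L p := fun p => Real.log_nonneg (by linarith [sq_nonneg (f (Pp p) / p.1)])
  have hR0 : ∀ p : ℝ × ℝ, R < p.1 → 0 < p.1 → a p = 0 := by
    intro p hp hp0
    have : ψ (Pp p) = 0 := by
      by_contra hne
      have := hR (Pp p) (subset_tsupport _ hne)
      rw [norm_Pp, abs_of_pos hp0] at this
      linarith
    simp only [ha, this, zero_mul]
  obtain ⟨F, hF1, hF2, hF3⟩ := assemble (a := a) (L := L) (R := max R 0) (M := M) (K := K ^ 2) ca cL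
    (fun p hp => hR0 p (lt_of_le_of_lt (le_max_left _ _) hp) (lt_of_le_of_lt (le_max_right _ _) hp))
    (fun p _ => hM (Pp p)) (by positivity) L0
    (by
      intro p hp hpR
      have hpR' : p.1 ≤ R := by
        rcases le_max_iff.1 hpR with h | h
        · exact h
        · linarith
      have h1 : L p ≤ (f (Pp p) / p.1) ^ 2 := by
        have := Real.log_le_sub_one_of_pos (show 0 < 1 + (f (Pp p) / p.1) ^ 2 by positivity)
        simp only [hL]; linarith
      refine h1.trans ?_
      have h2 := hK (Pp p) (by rw [norm_Pp, abs_of_pos hp]; exact hpR')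
      rw [norm_Pp, abs_of_pos hp] at h2
      have h3 : |f (Pp p) / p.1| ≤ K * p.1 := by
        rw [abs_div, abs_of_pos hp, div_le_iff₀ hp]
        exact h2.trans (le_of_eq (by ring))
      rw [← sq_abs, ← mul_pow]
      exact pow_le_pow_left₀ (abs_nonneg _) h3 2)
    Xa XaL XaL2'
    (by intro t; simp only [aBx, aBy, aCx, aCy]; ring)
    (by intro t; simp only [aBx, aBy, aCx, aCy, aB, aC]; ring)
    (by intro t; simp only [aBx, aBy, aCx, aCy, aB, aC]; ring)
  refine ⟨F, ?_, hF2, ?_⟩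
  · intro s hs
    rw [hF1 s hs, integral_polar]
    refine integral_congr_ae ?_
    filter_upwards [pm_pos] with p hp
    have hq := cpow_polar (y := f (Pp p)) hp s
    rw [norm_Pp, sq_abs, grad_sq]
    simp only [ha, hL]
    push_cast at hq ⊢
    linear_combination (-(ψ (Pp p) : ℂ) *
      ((Real.sqrt (1 + (D vx f (Pp p) ^ 2 + D vy f (Pp p) ^ 2)) : ℝ) : ℂ)) * hq
  · refine hF3.trans (le_of_eq ?_)
    congr 2
    refine intervalIntegral.integral_congr fun t _ => ?_
    simp only [hB, hCc, hDd, hBx, hBy, hCx, hCy, hDx, hDy, tot]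
    ring

end Bry

/-- Theorem 4.1, residue at `s = -6`: for a surface in `ℝ³` given locally
as the graph of a smooth `f : ℝ² → ℝ` with `f(0) = 0`, `∇f(0) = 0`, the localized
pointwise Brylinski beta function
`B(s) = ∫_{ℝ²} (‖w‖² + f(w)²)^(s/2) ψ(w) √(1 + ‖∇f(w)‖²) dw`
admits an analytic continuation `F` to `{Re s > -7} \ {-2, -4, -6}` whose residue at
`s = -6` is the stated polynomial in the Taylor coefficients of `f` at `0`.
Here `eₓ = EuclideanSpace.single 0 1` and `e_y = EuclideanSpace.single 1 1`, and the
Taylor coefficients are expressed through the iterated derivatives of `f` at `0`. -/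
theorem brylinski_beta_surface_residue_neg_six
    (f : EuclideanSpace ℝ (Fin 2) → ℝ)
    (hf : ContDiff ℝ (⊤ : ℕ∞) f) (hf0 : f 0 = 0) (hgrad : gradient f 0 = 0)
    (ψ : EuclideanSpace ℝ (Fin 2) → ℝ)
    (hψ : ContDiff ℝ (⊤ : ℕ∞) ψ) (hψc : HasCompactSupport ψ)
    (hψ1 : ∀ᶠ w in nhds (0 : EuclideanSpace ℝ (Fin 2)), ψ w = 1)
    (ex ey : EuclideanSpace ℝ (Fin 2))
    (hex : ex = EuclideanSpace.single 0 1) (hey : ey = EuclideanSpace.single 1 1)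
    (b₁ b₂ b₃ c₁ c₂ c₃ c₄ d₁ d₂ d₃ d₄ d₅ : ℝ)
    (hb₁ : b₁ = (1 / 2) * iteratedFDeriv ℝ 2 f 0 ![ex, ex])
    (hb₂ : b₂ = iteratedFDeriv ℝ 2 f 0 ![ex, ey])
    (hb₃ : b₃ = (1 / 2) * iteratedFDeriv ℝ 2 f 0 ![ey, ey])
    (hc₁ : c₁ = (1 / 6) * iteratedFDeriv ℝ 3 f 0 ![ex, ex, ex])
    (hc₂ : c₂ = (1 / 2) * iteratedFDeriv ℝ 3 f 0 ![ex, ex, ey])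
    (hc₃ : c₃ = (1 / 2) * iteratedFDeriv ℝ 3 f 0 ![ex, ey, ey])
    (hc₄ : c₄ = (1 / 6) * iteratedFDeriv ℝ 3 f 0 ![ey, ey, ey])
    (hd₁ : d₁ = (1 / 24) * iteratedFDeriv ℝ 4 f 0 ![ex, ex, ex, ex])
    (hd₂ : d₂ = (1 / 6) * iteratedFDeriv ℝ 4 f 0 ![ex, ex, ex, ey])
    (hd₃ : d₃ = (1 / 4) * iteratedFDeriv ℝ 4 f 0 ![ex, ex, ey, ey])
    (hd₄ : d₄ = (1 / 6) * iteratedFDeriv ℝ 4 f 0 ![ex, ey, ey, ey])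
    (hd₅ : d₅ = (1 / 24) * iteratedFDeriv ℝ 4 f 0 ![ey, ey, ey, ey]) :
    ∃ F : ℂ → ℂ,
      (∀ s : ℂ, -2 < s.re →
        F s = ∫ w : EuclideanSpace ℝ (Fin 2),
          (((‖w‖ ^ 2 + (f w) ^ 2 : ℝ) : ℂ) ^ (s / 2)) * (ψ w : ℂ)
            * ((Real.sqrt (1 + ‖gradient f w‖ ^ 2) : ℝ) : ℂ)) ∧
      (∀ s : ℂ, -7 < s.re → s ≠ -2 → s ≠ -4 → s ≠ -6 → DifferentiableAt ℂ F s) ∧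
      Tendsto (fun s : ℂ => (s + 6) * F s) (nhdsWithin (-6 : ℂ) {(-6 : ℂ)}ᶜ)
        (nhds (((Real.pi / 32) *
          (72 * b₃ * d₅ - 24 * b₁ * d₅ + 24 * b₂ * d₄ + 48 * c₄ ^ 2
            + 8 * b₃ * d₃ + 8 * b₁ * d₃ + 16 * c₃ ^ 2 - 63 * b₃ ^ 4
            + 12 * b₁ * b₃ ^ 3 - 66 * b₂ ^ 2 * b₃ ^ 2 - 26 * b₁ ^ 2 * b₃ ^ 2
            - 44 * b₁ * b₂ ^ 2 * b₃ - 24 * b₃ * d₁ + 12 * b₁ ^ 3 * b₃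
            + 24 * b₂ * d₂ + 16 * c₂ ^ 2 - 11 * b₂ ^ 4 - 66 * b₁ ^ 2 * b₂ ^ 2
            + 72 * b₁ * d₁ + 48 * c₁ ^ 2 - 63 * b₁ ^ 4) : ℝ) : ℂ)) := by
  subst hex hey
  rw [← Bry.trig_final b₁ b₂ b₃ c₁ c₂ c₃ c₄ d₁ d₂ d₃ d₄ d₅]
  exact Bry.main f hf hf0 hgrad ψ hψ hψc hψ1 b₁ b₂ b₃ c₁ c₂ c₃ c₄ d₁ d₂ d₃ d₄ d₅
    hb₁ hb₂ hb₃ hc₁ hc₂ hc₃ hc₄ hd₁ hd₂ hd₃ hd₄ hd₅
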